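/- arXiv:2402.00542 — 2 statements merged into one kernel-verified Lean document; each statement's English description precedes it below -/
import Mathlib

section
/- There is a constant K such that for every n, all A, B ⊆ X = {x_1,…,x_n} with |A| ≥ 4, |B| ≥ 4 and |A△B| ≥ 4, and all orderings σ_a of A and σ_b of B, the formula rAddPar(a,b) has a DRAT⁻ refutation with at most K·n·log n lines. -/
abbrev Lit (ν : Type) := ν × Bool
abbrev Clause (ν : Type) := Finset (ν × Bool)
abbrev CNF (ν : Type) := Finset (Finset (ν × Bool))

variable {ν : Type} [DecidableEq ν]

/-- Negation of a literal. -/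
def negLit (l : Lit ν) : Lit ν := (l.1, !l.2)

/-- Canonical CNF encoding of the parity constraint `l₁ ⊕ ⋯ ⊕ l_k = c` for the
literals in the list `ls`: the clauses forbid exactly the assignments under which
the number of true literals among `ls` has parity different from `c`. -/
def parityCNF (ls : List (Lit ν)) (c : Bool) : CNF ν :=
  ((Finset.univ : Finset (Fin ls.length → Bool)).filter
      (fun f => (Finset.univ.filter (fun i => f i = true)).card % 2 = (if c then 0 else 1))).image
    (fun f => Finset.univ.image (fun i => if f i then negLit (ls.get i) else ls.get i))

/-- `xor(l₁,…,l_k)`: canonical CNF encoding of `l₁ ⊕ ⋯ ⊕ l_k = 0`. -/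
def xorCNF (ls : List (Lit ν)) : CNF ν := parityCNF ls false

def clauseSat (τ : ν → Bool) (C : Clause ν) : Prop := ∃ l ∈ C, τ l.1 = l.2

def cnfSat (τ : ν → Bool) (F : CNF ν) : Prop := ∀ C ∈ F, clauseSat τ C

def Unsat (F : CNF ν) : Prop := ¬ ∃ τ : ν → Bool, cnfSat τ F

def cnfVars (F : CNF ν) : Set ν := {v | ∃ C ∈ F, ∃ b, (v, b) ∈ C}

def clauseVars (C : Clause ν) : Set ν := {v | ∃ b, (v, b) ∈ C}

/-- `R` is the resolvent of `C` and `D`. -/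
def IsResolvent (C D R : Clause ν) : Prop :=
  ∃ v : ν, (v, true) ∈ C ∧ (v, false) ∈ D ∧ R = C.erase (v, true) ∪ D.erase (v, false)

/-- A resolution refutation of `F`: a sequence of clauses, each an axiom of `F` or a
resolvent of two earlier clauses, ending with the empty clause. Its length is `L.length`. -/
def IsResRefutation (F : CNF ν) (L : List (Clause ν)) : Prop :=
  L ≠ [] ∧ L.getLast? = some (∅ : Clause ν) ∧
    ∀ i, (hi : i < L.length) →
      L[i] ∈ F ∨ ∃ j k, ∃ (hj : j < i) (hk : k < i),
        IsResolvent (L[j]'(hj.trans hi)) (L[k]'(hk.trans hi)) L[i]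

/-- The `j`-th xor constraint (0-based) of `Parity(xs, t)`: for a list `xs` of `n ≥ 4`
literals and Tseitin variables `t 0, …, t (n-4)`, constraint `0` is
`xor(xs[0], xs[1], t 0)`, constraint `j` for `1 ≤ j ≤ n-4` is
`xor(t (j-1), xs[j+1], t j)`, and constraint `n-3` is `xor(t (n-4), xs[n-2], xs[n-1])`. -/
def parityCtr (xs : List (Lit ν)) (t : ℕ → ν) (j : ℕ) : List (Lit ν) :=
  if j = 0 then [xs.getD 0 (t 0, true), xs.getD 1 (t 0, true), (t 0, true)]
  else if j < xs.length - 3 then [(t (j - 1), true), xs.getD (j + 1) (t 0, true), (t j, true)]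
  else [(t (xs.length - 4), true), xs.getD (xs.length - 2) (t 0, true),
    xs.getD (xs.length - 1) (t 0, true)]

/-- The standard linear CNF encoding `Parity(xs, t)` of the parity constraint
`xs[0] ⊕ ⋯ ⊕ xs[n-1] = 0` using Tseitin variables `t 0, …, t (n-4)`. -/
def ParityCNF (xs : List (Lit ν)) (t : ℕ → ν) : CNF ν :=
  (Finset.range (xs.length - 2)).biUnion (fun j => xorCNF (parityCtr xs t j))

/-- The elements of `A` listed in the order induced by the permutation `σ`. -/
def orderedElems {n : ℕ} (A : Finset (Fin n)) (σ : Equiv.Perm (Fin n)) : List (Fin n) :=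
  (List.ofFn (fun i => σ i)).filter (fun i => decide (i ∈ A))

/-- Positive literals for a list of variables, variable `i : Fin n` encoded as `(i : ℕ)`. -/
def posLits {n : ℕ} (l : List (Fin n)) : List (Lit ℕ) := l.map (fun i => ((i : ℕ), true))

/-- The literals of `C`: the symmetric difference `A △ B` in the order induced by `σc`,
all positive except that the literal on the maximal element of `A △ B` is flipped. -/
def symmLits {n : ℕ} (A B : Finset (Fin n)) (σc : Equiv.Perm (Fin n)) : List (Lit ℕ) :=
  (orderedElems (symmDiff A B) σc).map
    (fun (i : Fin n) => ((i : ℕ), decide ((i : WithBot (Fin n)) ≠ (symmDiff A B).max)))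

/-- `rAddPar(a, b, σc) = Parity(A, S, σa) ∧ Parity(B, T, σb) ∧ Parity(C, U, σc)` where
`C` is `A △ B` with one literal flipped; `S`, `T`, `U` are encoded as `n + k`, `2n + k`,
`3n + k` respectively. -/
def rAddPar (n : ℕ) (A B : Finset (Fin n)) (σa σb σc : Equiv.Perm (Fin n)) : CNF ℕ :=
  ParityCNF (posLits (orderedElems A σa)) (fun k => n + k) ∪
    ParityCNF (posLits (orderedElems B σb)) (fun k => 2 * n + k) ∪
    ParityCNF (symmLits A B σc) (fun k => 3 * n + k)

/-- The CNF `¬C` consisting of the unit clauses negating the literals of `C`. -/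
def clauseNegCNF (C : Clause ν) : CNF ν := C.image (fun l => ({negLit l} : Clause ν))

/-- One step of unit propagation: pick a unit clause `{l}` of `F`, resolve it with every
clause of `F` containing the negation of `l`, then remove `{l}`. -/
def UPStep (F F' : CNF ν) : Prop :=
  ∃ l : Lit ν, ({l} : Clause ν) ∈ F ∧
    F' = (F.erase {l}) ∪
      (F.filter (fun C => negLit l ∈ C)).image (fun C => C.erase (negLit l))

/-- `F ⊢₁ ⊥`: unit propagation from `F` derives the empty clause. -/
def UPRefutes (F : CNF ν) : Prop :=
  ∃ F', Relation.ReflTransGen UPStep F F' ∧ (∅ : Clause ν) ∈ F'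

/-- `C` is an asymmetric tautology (AT) w.r.t. `F`: `F ∧ ¬C ⊢₁ ⊥`. -/
def IsAT (F : CNF ν) (C : Clause ν) : Prop := UPRefutes (F ∪ clauseNegCNF C)

/-- `C` is a resolution asymmetric tautology (RAT) w.r.t. `F`. -/
def IsRAT (F : CNF ν) (C : Clause ν) : Prop :=
  ∃ l ∈ C, ∀ D ∈ F, negLit l ∈ D →
    UPRefutes (F ∪ clauseNegCNF (D.erase (negLit l)) ∪ clauseNegCNF C)

/-- A DRAT step: add a clause that is AT or RAT w.r.t. the current formula, or delete a
clause that is AT or RAT w.r.t. the remaining formula. -/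
def DRATStep (F F' : CNF ν) : Prop :=
  (∃ C : Clause ν, (IsAT F C ∨ IsRAT F C) ∧ F' = insert C F) ∨
  (∃ C ∈ F, (IsAT (F.erase C) C ∨ IsRAT (F.erase C) C) ∧ F' = F.erase C)

/-- A DRAT refutation of `F`: a sequence of formulas starting at `F`, linked by DRAT
steps, whose final formula contains the empty clause. Its number of lines is
`Fs.length - 1` (the number of steps). -/
def IsDRATRefutation (F : CNF ν) (Fs : List (CNF ν)) : Prop :=
  Fs ≠ [] ∧ List.Chain' DRATStep Fs ∧ Fs.head? = some F ∧
    ∃ G, Fs.getLast? = some G ∧ (∅ : Clause ν) ∈ G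

/-- The derivation `Fs` uses no variables other than those of `F` (DRAT⁻ condition). -/
def NoNewVars (F : CNF ν) (Fs : List (CNF ν)) : Prop :=
  ∀ G ∈ Fs, cnfVars G ⊆ cnfVars F

set_option linter.unusedSectionVars false
set_option linter.deprecated false

namespace RP

/-! ### Unit propagation, abstractly -/

theorem negLit_negLit (l : Lit ν) : negLit (negLit l) = l := by
  simp [negLit]

theorem negLit_ne (l : Lit ν) : negLit l ≠ l := by
  intro h
  have := congrArg Prod.snd h
  simp [negLit] at this

/-- Unit propagation as a closure process on sets of true literals. -/
inductive UPR (F : CNF ν) : Set (Lit ν) → Prop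
  | incons (P : Set (Lit ν)) (l : Lit ν) : l ∈ P → negLit l ∈ P → UPR F P
  | conflict (P : Set (Lit ν)) (C : Clause ν) : C ∈ F → (∀ m ∈ C, negLit m ∈ P) → UPR F P
  | unit (P : Set (Lit ν)) (C : Clause ν) (l : Lit ν) : C ∈ F →
      (∀ m ∈ C, m = l ∨ negLit m ∈ P) → UPR F (insert l P) → UPR F P

theorem UPR.mono {F G : CNF ν} (hFG : F ⊆ G) {P : Set (Lit ν)} (h : UPR F P) : UPR G P := by
  induction h with
  | incons P l h1 h2 => exact .incons P l h1 h2
  | conflict P C h1 h2 => exact .conflict P C (hFG h1) h2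
  | unit P C l h1 h2 _ ih => exact .unit P C l (hFG h1) h2 ih

open Classical in
theorem UPR.sound {F : CNF ν} {P : Set (Lit ν)} (h : UPR F P) :
    ∀ G : CNF ν, (∀ l ∈ P, negLit l ∉ P) →
      (∀ C ∈ F, C.filter (fun m => negLit m ∉ P) ∈ G ∨
        ∃ l ∈ P, C.filter (fun m => negLit m ∉ P) = {l}) → UPRefutes G := by
  induction h with
  | incons P l h1 h2 => intro G hc; exact absurd h2 (hc l h1)
  | conflict P C h1 h2 =>
    intro G hc hI
    have he : C.filter (fun m => negLit m ∉ P) = ∅ := by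
      apply Finset.filter_false_of_mem
      intro m hm; simpa using h2 m hm
    rcases hI C h1 with h | ⟨l, _, h⟩
    · rw [he] at h
      exact ⟨G, .refl, h⟩
    · rw [he] at h
      exact absurd h.symm (Finset.singleton_ne_empty l)
  | unit P C l h1 h2 _ ih =>
    intro G hc hI
    by_cases hl : l ∈ P
    · rw [Set.insert_eq_of_mem hl] at ih
      exact ih G hc hI
    have hsub : ∀ m ∈ C.filter (fun m => negLit m ∉ P), m = l := by
      intro m hm
      rw [Finset.mem_filter] at hm
      exact (h2 m hm.1).resolve_right hm.2
    rcases Finset.subset_singleton_iff.1 (fun m hm => Finset.mem_singleton.2 (hsub m hm)) with he | he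
    · rcases hI C h1 with h | ⟨l', _, h⟩
      · rw [he] at h
        exact ⟨G, .refl, h⟩
      · rw [he] at h
        exact absurd h.symm (Finset.singleton_ne_empty _)
    have hlC : l ∈ C.filter (fun m => negLit m ∉ P) := by rw [he]; simp
    have hnl : negLit l ∉ P := (Finset.mem_filter.1 hlC).2
    have hG : {l} ∈ G := by
      rcases hI C h1 with h | ⟨l', h', h⟩
      · rwa [he] at h
      · rw [he] at h
        rw [Finset.singleton_inj] at h
        exact absurd (h ▸ h') hl
    have key := ih ((G.erase {l}) ∪
      (G.filter (fun C => negLit l ∈ C)).image (fun C => C.erase (negLit l))) ?_ ?_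
    · obtain ⟨F', hF, h0⟩ := key
      exact ⟨F', .head ⟨l, hG, rfl⟩ hF, h0⟩
    · intro m hm hm'
      rcases hm with rfl | hm
      · rcases hm' with h | h
        · exact negLit_ne _ h
        · exact hnl h
      · rcases hm' with h | h
        · rw [← h, negLit_negLit] at hnl
          exact hnl hm
        · exact hc m hm h
    · intro D hD
      have heq : ∀ inst : DecidablePred (fun m => negLit m ∉ insert l P),
          @Finset.filter _ (fun m => negLit m ∉ insert l P) inst D =
          (D.filter (fun m => negLit m ∉ P)).erase (negLit l) := by
        intro inst
        ext m
        simp only [Finset.mem_filter, Finset.mem_erase, Set.mem_insert_iff, not_or]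
        constructor
        · rintro ⟨a, b, c⟩
          refine ⟨?_, a, c⟩
          rintro rfl
          exact b (negLit_negLit l)
        · rintro ⟨a, b, c⟩
          refine ⟨b, ?_, c⟩
          rintro rfl
          exact a (negLit_negLit m).symm
      rw [heq]
      rcases hI D hD with h | ⟨l', h', h⟩
      · by_cases hm : negLit l ∈ D.filter (fun m => negLit m ∉ P)
        · left
          apply Finset.mem_union_right
          exact Finset.mem_image.2 ⟨_, Finset.mem_filter.2 ⟨h, hm⟩, rfl⟩
        · rw [Finset.erase_eq_of_notMem hm]
          by_cases hs : D.filter (fun m => negLit m ∉ P) = {l}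
          · right; exact ⟨l, Set.mem_insert _ _, hs⟩
          · left
            exact Finset.mem_union_left _ (Finset.mem_erase.2 ⟨hs, h⟩)
      · right
        refine ⟨l', Set.mem_insert_of_mem _ h', ?_⟩
        rw [h, Finset.erase_eq_of_notMem]
        rw [Finset.mem_singleton]
        rintro rfl
        exact hnl h'

theorem UPR.refutes {F : CNF ν} (h : UPR F ∅) : UPRefutes F := by
  apply h.sound F
  · simp
  · intro C hC
    left
    simpa using hC

theorem UPR.units {F : CNF ν} (S : Finset (Lit ν)) (hS : ∀ l ∈ S, ({l} : Clause ν) ∈ F)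
    (h : UPR F (S : Set (Lit ν))) : UPR F ∅ := by
  induction S using Finset.induction_on with
  | empty => simpa using h
  | insert a S ha ih =>
    apply ih (fun l hl => hS l (Finset.mem_insert_of_mem hl))
    refine .unit _ {a} a (hS a (Finset.mem_insert_self _ _)) ?_ (by simpa using h)
    intro m hm; left; simpa using hm

theorem isAT_of {F : CNF ν} {C : Clause ν} (h : UPR F {l | negLit l ∈ C}) : IsAT F C := by
  apply UPR.refutes
  apply UPR.units (C.image negLit)
  · intro l hl
    apply Finset.mem_union_right
    obtain ⟨m, hm, rfl⟩ := Finset.mem_image.1 hl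
    exact Finset.mem_image.2 ⟨m, hm, rfl⟩
  · have : ((C.image negLit : Finset (Lit ν)) : Set (Lit ν)) = {l | negLit l ∈ C} := by
      ext l
      simp only [Finset.coe_image, Set.mem_image, Finset.mem_coe, Set.mem_ofPred_eq]
      constructor
      · rintro ⟨m, hm, rfl⟩; rwa [negLit_negLit]
      · intro h; exact ⟨_, h, negLit_negLit l⟩
    rw [this]
    exact h.mono Finset.subset_union_left

theorem isRAT_of {F : CNF ν} {C : Clause ν} (l : Lit ν) (hl : l ∈ C)
    (h : ∀ D ∈ F, negLit l ∈ D →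
      UPR F {m | negLit m ∈ C ∨ (negLit m ≠ negLit l ∧ negLit m ∈ D)}) : IsRAT F C := by
  refine ⟨l, hl, fun D hD hlD => ?_⟩
  apply UPR.refutes
  apply UPR.units ((D.erase (negLit l)).image negLit ∪ C.image negLit)
  · intro l hl
    rcases Finset.mem_union.1 hl with hl | hl
    · apply Finset.mem_union_left
      apply Finset.mem_union_right
      obtain ⟨m, hm, rfl⟩ := Finset.mem_image.1 hl
      exact Finset.mem_image.2 ⟨m, hm, rfl⟩
    · apply Finset.mem_union_right
      obtain ⟨m, hm, rfl⟩ := Finset.mem_image.1 hl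
      exact Finset.mem_image.2 ⟨m, hm, rfl⟩
  · have key : ∀ (E : Finset (Lit ν)) (m : Lit ν), m ∈ E.image negLit ↔ negLit m ∈ E := by
      intro E m
      rw [Finset.mem_image]
      constructor
      · rintro ⟨m, hm, rfl⟩; rwa [negLit_negLit]
      · intro h; exact ⟨_, h, negLit_negLit m⟩
    have : (((D.erase (negLit l)).image negLit ∪ C.image negLit : Finset (Lit ν)) : Set (Lit ν))
        = {m | negLit m ∈ C ∨ (negLit m ≠ negLit l ∧ negLit m ∈ D)} := by
      ext m
      rw [Finset.mem_coe, Finset.mem_union, key, key, Finset.mem_erase, Set.mem_ofPred_eq, or_comm]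
    rw [this]
    apply (h D hD hlD).mono
    rw [Finset.union_assoc]
    exact Finset.subset_union_left

/-! ### Bounded derivations -/

/-- `Der V k F G`: `G` is derivable from `F` in at most `k` DRAT steps, all formulas
having their variables in `V`. -/
inductive Der (V : Set ν) : ℕ → CNF ν → CNF ν → Prop
  | refl (F : CNF ν) : cnfVars F ⊆ V → Der V 0 F F
  | step {k : ℕ} {F G H : CNF ν} : cnfVars F ⊆ V → DRATStep F G → Der V k G H → Der V (k + 1) F H
  | skip {k : ℕ} {F G : CNF ν} : Der V k F G → Der V (k + 1) F G

theorem Der.le {V : Set ν} {k k' : ℕ} {F G : CNF ν} (h : Der V k F G) (hk : k ≤ k') :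
    Der V k' F G := by
  induction hk with
  | refl => exact h
  | step _ ih => exact .skip ih

theorem Der.vars_left {V : Set ν} {k : ℕ} {F G : CNF ν} (h : Der V k F G) : cnfVars F ⊆ V := by
  induction h with
  | refl F h => exact h
  | step h _ _ _ => exact h
  | skip _ ih => exact ih

theorem Der.vars_right {V : Set ν} {k : ℕ} {F G : CNF ν} (h : Der V k F G) : cnfVars G ⊆ V := by
  induction h with
  | refl F h => exact h
  | step h _ _ ih => exact ih
  | skip _ ih => exact ih

theorem Der.trans {V : Set ν} {a b : ℕ} {F G H : CNF ν} (h : Der V a F G) (h' : Der V b G H) :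
    Der V (a + b) F H := by
  induction h with
  | refl F _ => exact h'.le (by omega)
  | step hv hs _ ih => exact (Der.step hv hs (ih h')).le (by omega)
  | skip _ ih => exact (ih h').le (by omega)

theorem DRATStep.symm' {F G : CNF ν} (h : DRATStep F G) : F = G ∨ DRATStep G F := by
  rcases h with ⟨C, hC, rfl⟩ | ⟨C, hCF, hC, rfl⟩
  · by_cases hm : C ∈ F
    · left; rw [Finset.insert_eq_of_mem hm]
    · right; right
      refine ⟨C, Finset.mem_insert_self _ _, ?_, ?_⟩
      · rwa [Finset.erase_insert hm]
      · rw [Finset.erase_insert hm]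
  · right; left
    exact ⟨C, hC, (Finset.insert_erase hCF).symm⟩

theorem Der.symm {V : Set ν} {k : ℕ} {F G : CNF ν} (h : Der V k F G) : Der V k G F := by
  induction h with
  | refl F h => exact .refl F h
  | step hv hs hd ih =>
    rcases DRATStep.symm' hs with rfl | h'
    · exact .skip ih
    · exact ih.trans (Der.step (hd.vars_left) h' (.refl _ hv))
  | skip _ ih => exact .skip ih

theorem cnfVars_mono {F G : CNF ν} (h : F ⊆ G) : cnfVars F ⊆ cnfVars G := by
  rintro v ⟨C, hC, b, hb⟩
  exact ⟨C, h hC, b, hb⟩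

theorem cnfVars_union (F G : CNF ν) : cnfVars (F ∪ G) = cnfVars F ∪ cnfVars G := by
  ext v
  simp only [cnfVars, Finset.mem_union, Set.mem_ofPred_eq, Set.mem_union]
  constructor
  · rintro ⟨C, h | h, b⟩
    · exact Or.inl ⟨C, h, b⟩
    · exact Or.inr ⟨C, h, b⟩
  · rintro (⟨C, h, b⟩ | ⟨C, h, b⟩)
    · exact ⟨C, Or.inl h, b⟩
    · exact ⟨C, Or.inr h, b⟩

/-- Adding a set of clauses one after the other. -/
theorem Der.addSet {V : Set ν} (G S : CNF ν) (hV : cnfVars (G ∪ S) ⊆ V)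
    (h : ∀ C ∈ S, ∀ S' ⊆ S, IsAT (G ∪ S') C ∨ IsRAT (G ∪ S') C) : Der V S.card G (G ∪ S) := by
  suffices H : ∀ S' : CNF ν, S' ⊆ S → Der V S'.card G (G ∪ S') from H S (Finset.Subset.refl _)
  intro S'
  induction S' using Finset.induction_on with
  | empty =>
    intro _
    rw [Finset.union_empty]
    exact .refl _ ((cnfVars_mono Finset.subset_union_left).trans hV)
  | insert C S' hC ih =>
    intro hs
    have hs' : S' ⊆ S := (Finset.subset_insert _ _).trans hs
    rw [Finset.card_insert_of_notMem hC]
    refine (ih hs').trans (b := 1) ?_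
    have hv : ∀ T ⊆ S, cnfVars (G ∪ T) ⊆ V := fun T hT =>
      (cnfVars_mono (Finset.union_subset_union_right hT)).trans hV
    refine Der.step (hv _ hs') (Or.inl ⟨C, h C (hs (Finset.mem_insert_self _ _)) S' hs', ?_⟩)
      (.refl _ (hv _ hs))
    rw [Finset.union_insert]

theorem Der.addAT {V : Set ν} (G S : CNF ν) (hV : cnfVars (G ∪ S) ⊆ V)
    (h : ∀ C ∈ S, UPR G {l | negLit l ∈ C}) : Der V S.card G (G ∪ S) :=
  Der.addSet G S hV fun C hC _ _ => Or.inl (isAT_of ((h C hC).mono Finset.subset_union_left))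

theorem Der.toList {V : Set ν} {k : ℕ} {F G : CNF ν} (h : Der V k F G) :
    ∃ Fs : List (CNF ν), Fs ≠ [] ∧ List.IsChain DRATStep Fs ∧ Fs.head? = some F ∧
      Fs.getLast? = some G ∧ (∀ H ∈ Fs, cnfVars H ⊆ V) ∧ Fs.length ≤ k + 1 := by
  induction h with
  | refl F h => exact ⟨[F], by simp, by simp, by simp, by simp, by simpa using h, by simp⟩
  | @step k F G H hv hs hd ih =>
    obtain ⟨Fs, h1, h2, h3, h4, h5, h6⟩ := ih
    refine ⟨F :: Fs, by simp, ?_, by simp, ?_, ?_, by simpa using h6⟩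
    · rw [List.isChain_cons]
      refine ⟨?_, h2⟩
      intro y hy
      rw [h3] at hy
      simp only [Option.mem_def, Option.some.injEq] at hy
      exact hy ▸ hs
    · rw [List.getLast?_cons, h4]; rfl
    · intro X hX
      rcases List.mem_cons.1 hX with rfl | hX
      · exact hv
      · exact h5 X hX
  | skip _ ih =>
    obtain ⟨Fs, h1, h2, h3, h4, h5, h6⟩ := ih
    exact ⟨Fs, h1, h2, h3, h4, h5, by omega⟩

/-! ### Three- and four-variable parity constraints -/

/-- Clauses of the constraint on `a, b, c` (sign patterns with xor `p`). -/
def X3 (a b c : ν) (p : Bool) : CNF ν :=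
  ((Finset.univ : Finset (Bool × Bool × Bool)).filter
    (fun s => xor s.1 (xor s.2.1 s.2.2) = p)).image
      (fun s => {(a, s.1), (b, s.2.1), (c, s.2.2)})

def X4 (a b c d : ν) : CNF ν :=
  ((Finset.univ : Finset (Bool × Bool × Bool × Bool)).filter
    (fun s => xor s.1 (xor s.2.1 (xor s.2.2.1 s.2.2.2)) = true)).image
      (fun s => {(a, s.1), (b, s.2.1), (c, s.2.2.1), (d, s.2.2.2)})

theorem mem_X3 {a b c : ν} {p : Bool} {C : Clause ν} : C ∈ X3 a b c p ↔
    ∃ i j k, xor i (xor j k) = p ∧ C = {(a, i), (b, j), (c, k)} := by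
  simp only [X3, Finset.mem_image, Finset.mem_filter, Finset.mem_univ, true_and, Prod.exists]
  simp only [eq_comm]

theorem mem_X4 {a b c d : ν} {C : Clause ν} : C ∈ X4 a b c d ↔
    ∃ i j k m, xor i (xor j (xor k m)) = true ∧ C = {(a, i), (b, j), (c, k), (d, m)} := by
  simp only [X4, Finset.mem_image, Finset.mem_filter, Finset.mem_univ, true_and, Prod.exists]
  simp only [eq_comm]

theorem card_X3 (a b c : ν) (p : Bool) : (X3 a b c p).card ≤ 4 := by
  refine Finset.card_image_le.trans ?_
  revert p; decide

theorem card_X4 (a b c d : ν) : (X4 a b c d).card ≤ 8 := by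
  refine Finset.card_image_le.trans ?_
  decide

theorem X3_swap12 (a b c : ν) (p : Bool) : X3 a b c p = X3 b a c p := by
  ext C
  rw [mem_X3, mem_X3]
  constructor <;>
  · rintro ⟨i, j, k, h, rfl⟩
    refine ⟨j, i, k, ?_, Finset.insert_comm _ _ _⟩
    rw [← h]; cases i <;> cases j <;> cases k <;> rfl

theorem X3_swap23 (a b c : ν) (p : Bool) : X3 a b c p = X3 a c b p := by
  ext C
  rw [mem_X3, mem_X3]
  constructor <;>
  · rintro ⟨i, j, k, h, rfl⟩
    refine ⟨i, k, j, ?_, by rw [Finset.pair_comm]⟩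
    rw [← h]; cases i <;> cases j <;> cases k <;> rfl

theorem X4_rot (a b c d : ν) : X4 a b c d = X4 c a b d := by
  ext C
  rw [mem_X4, mem_X4]
  constructor
  · rintro ⟨i, j, k, m, h, rfl⟩
    refine ⟨k, i, j, m, ?_, ?_⟩
    · rw [← h]; cases i <;> cases j <;> cases k <;> cases m <;> rfl
    · ext x; simp only [Finset.mem_insert, Finset.mem_singleton]; tauto
  · rintro ⟨i, j, k, m, h, rfl⟩
    refine ⟨j, k, i, m, ?_, ?_⟩
    · rw [← h]; cases i <;> cases j <;> cases k <;> cases m <;> rfl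
    · ext x; simp only [Finset.mem_insert, Finset.mem_singleton]; tauto

theorem cnfVars_X3 (a b c : ν) (p : Bool) : cnfVars (X3 a b c p) = {a, b, c} := by
  ext v
  simp only [cnfVars, Set.mem_ofPred_eq, mem_X3, Set.mem_insert_iff, Set.mem_singleton_iff]
  constructor
  · rintro ⟨C, ⟨i, j, k, _, rfl⟩, b', hb⟩
    simp only [Finset.mem_insert, Finset.mem_singleton, Prod.mk.injEq] at hb
    tauto
  · intro h
    refine ⟨_, ⟨p, false, false, by simp, rfl⟩, ?_⟩
    rcases h with rfl | rfl | rfl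
    · exact ⟨p, by simp⟩
    · exact ⟨false, by simp⟩
    · exact ⟨false, by simp⟩

theorem cnfVars_X4 (a b c d : ν) : cnfVars (X4 a b c d) ⊆ {a, b, c, d} := by
  rintro v ⟨C, hC, b', hb⟩
  obtain ⟨i, j, k, m, _, rfl⟩ := mem_X4.1 hC
  simp only [Finset.mem_insert, Finset.mem_singleton, Prod.mk.injEq] at hb
  simp only [Set.mem_insert_iff, Set.mem_singleton_iff]
  rcases hb with ⟨h, _⟩ | ⟨h, _⟩ | ⟨h, _⟩ | ⟨h, _⟩
  · exact Or.inl h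
  · exact Or.inr (Or.inl h)
  · exact Or.inr (Or.inr (Or.inl h))
  · exact Or.inr (Or.inr (Or.inr h))

/-- Every sign pattern of a clause of the pair, split according to the Tseitin variable. -/
theorem pair_resolve {G : CNF ν} {p a b q t : ν} (hp : t ≠ p) (ha : t ≠ a) (hb : t ≠ b)
    (hq : t ≠ q) (hX : X4 p a b q ⊆ G) {C D : Clause ν} {s : Bool}
    (hC : C ∈ X3 p a t false ∪ X3 t b q false) (hD : D ∈ X3 p a t false ∪ X3 t b q false)
    (hCt : (t, s) ∈ C) (hDt : (t, !s) ∈ D) :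
    UPR G {m | negLit m ∈ C ∨ (negLit m ≠ (t, !s) ∧ negLit m ∈ D)} := by
  have hp' := hp.symm
  have ha' := ha.symm
  have hb' := hb.symm
  have hq' := hq.symm
  rw [Finset.mem_union, mem_X3, mem_X3] at hC hD
  rcases hC with ⟨i, j, k, h, rfl⟩ | ⟨k, i, j, h, rfl⟩ <;>
  rcases hD with ⟨i', j', k', h', rfl⟩ | ⟨k', i', j', h', rfl⟩ <;>
  simp only [Finset.mem_insert, Finset.mem_singleton, Prod.mk.injEq, hp, ha, hb, hq, false_and,
    true_and, false_or, or_false] at hCt hDt <;> subst hCt <;> subst hDt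
  · by_cases hi : i' = i
    · apply UPR.incons _ (a, j) <;>
      · cases i <;> cases j <;> cases j' <;> cases s <;> simp_all [negLit]
    · apply UPR.incons _ (p, i) <;>
      · cases i <;> cases i' <;> simp_all [negLit]
  · apply UPR.conflict _ _ (hX (mem_X4.2 ⟨i, j, i', j', ?_, rfl⟩))
    · intro m hm
      simp only [Finset.mem_insert, Finset.mem_singleton] at hm
      simp only [Set.mem_ofPred_eq, negLit_negLit]
      rcases hm with rfl | rfl | rfl | rfl <;> simp [hb.symm, hq.symm]
    · cases i <;> cases j <;> cases s <;> cases i' <;> cases j' <;> simp_all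
  · apply UPR.conflict _ _ (hX (mem_X4.2 ⟨i', j', i, j, ?_, rfl⟩))
    · intro m hm
      simp only [Finset.mem_insert, Finset.mem_singleton] at hm
      simp only [Set.mem_ofPred_eq, negLit_negLit]
      rcases hm with rfl | rfl | rfl | rfl <;> simp [hp.symm, ha.symm]
    · cases i <;> cases j <;> cases s <;> cases i' <;> cases j' <;> simp_all
  · by_cases hi : i' = i
    · apply UPR.incons _ (q, j) <;>
      · cases i <;> cases j <;> cases j' <;> cases s <;> simp_all [negLit]
    · apply UPR.incons _ (b, i) <;>
      · cases i <;> cases i' <;> simp_all [negLit]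

/-- Introducing a Tseitin variable for splitting a four-variable parity constraint. -/
theorem Der.intro4 {V : Set ν} {G : CNF ν} {p a b q t : ν} (hG : t ∉ cnfVars G)
    (hp : t ≠ p) (ha : t ≠ a) (hb : t ≠ b) (hq : t ≠ q) (hV : cnfVars G ⊆ V)
    (hpV : p ∈ V) (haV : a ∈ V) (hbV : b ∈ V) (hqV : q ∈ V) (htV : t ∈ V) :
    Der V 16 (G ∪ X4 p a b q) (G ∪ (X3 p a t false ∪ X3 t b q false)) := by
  have hV4 : cnfVars (X4 p a b q) ⊆ V := by
    refine (cnfVars_X4 _ _ _ _).trans ?_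
    rintro x (rfl | rfl | rfl | rfl) <;> assumption
  have hV3 : cnfVars (X3 p a t false ∪ X3 t b q false) ⊆ V := by
    rw [cnfVars_union, cnfVars_X3, cnfVars_X3]
    rintro x ((rfl | rfl | rfl) | (rfl | rfl | rfl)) <;> assumption
  have hcard : (X3 p a t false ∪ X3 t b q false).card ≤ 8 :=
    (Finset.card_union_le _ _).trans (Nat.add_le_add (card_X3 _ _ _ _) (card_X3 _ _ _ _))
  have hVall : cnfVars ((G ∪ X4 p a b q) ∪ (X3 p a t false ∪ X3 t b q false)) ⊆ V := by
    rw [cnfVars_union, cnfVars_union]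
    exact Set.union_subset (Set.union_subset hV hV4) hV3
  have hswap : (G ∪ X4 p a b q) ∪ (X3 p a t false ∪ X3 t b q false) =
      (G ∪ (X3 p a t false ∪ X3 t b q false)) ∪ X4 p a b q := by
    rw [Finset.union_right_comm]
  have h1 : Der V 8 (G ∪ X4 p a b q)
      ((G ∪ X4 p a b q) ∪ (X3 p a t false ∪ X3 t b q false)) := by
    refine (Der.addSet _ _ hVall ?_).le hcard
    intro C hC S' hS'
    right
    have hex : ∃ s, (t, s) ∈ C := by
      rw [Finset.mem_union, mem_X3, mem_X3] at hC
      rcases hC with ⟨i, j, k, h, rfl⟩ | ⟨k, i, j, h, rfl⟩ <;> exact ⟨k, by simp⟩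
    obtain ⟨s, hs⟩ := hex
    refine isRAT_of (t, s) hs ?_
    intro D hD hDt
    have hD' : D ∈ X3 p a t false ∪ X3 t b q false := by
      rcases Finset.mem_union.1 hD with hD | hD
      · exfalso
        have : t ∈ cnfVars (G ∪ X4 p a b q) := ⟨D, hD, _, hDt⟩
        rw [cnfVars_union] at this
        rcases this with h | h
        · exact hG h
        · have := cnfVars_X4 _ _ _ _ h
          simp only [Set.mem_insert_iff, Set.mem_singleton_iff] at this
          tauto
      · exact hS' hD
    exact pair_resolve hp ha hb hq (Finset.subset_union_right.trans Finset.subset_union_left)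
      hC hD' hs hDt
  have h2 : Der V 8 (G ∪ (X3 p a t false ∪ X3 t b q false))
      ((G ∪ X4 p a b q) ∪ (X3 p a t false ∪ X3 t b q false)) := by
    rw [hswap]
    refine (Der.addAT _ _ (hswap ▸ hVall) ?_).le (card_X4 _ _ _ _)
    intro C hC
    obtain ⟨i, j, k, m, h, rfl⟩ := mem_X4.1 hC
    apply UPR.unit _ {(p, i), (a, j), (t, xor i j)} (t, xor i j)
    · apply Finset.mem_union_right
      apply Finset.mem_union_left
      exact mem_X3.2 ⟨i, j, _, by cases i <;> cases j <;> rfl, rfl⟩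
    · intro x hx
      simp only [Finset.mem_insert, Finset.mem_singleton] at hx
      rcases hx with rfl | rfl | rfl <;> simp [negLit_negLit]
    · apply UPR.conflict _ {(t, !(xor i j)), (b, k), (q, m)}
      · apply Finset.mem_union_right
        apply Finset.mem_union_right
        refine mem_X3.2 ⟨_, k, m, ?_, rfl⟩
        revert h
        cases i <;> cases j <;> cases k <;> cases m <;> simp
      · intro x hx
        simp only [Finset.mem_insert, Finset.mem_singleton] at hx
        rcases hx with rfl | rfl | rfl
        · left; simp [negLit]
        · right; simp [negLit_negLit]
        · right; simp [negLit_negLit]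
  exact h1.trans h2.symm

end RP
namespace RP

/-! ### Parity trees -/

/-- Binary trees whose inner nodes are named by (Tseitin) variables. -/
inductive Tr : Type
  | leaf (x : ℕ) : Tr
  | node (p : ℕ) (l r : Tr) : Tr

namespace Tr

def v : Tr → ℕ
  | leaf x => x
  | node p _ _ => p

theorem v_leaf (x : ℕ) : (leaf x).v = x := rfl

theorem v_node (p : ℕ) (l r : Tr) : (node p l r).v = p := rfl

def labels : Tr → List ℕ
  | leaf _ => []
  | node p l r => p :: (labels l ++ labels r)

def leaves : Tr → List ℕ
  | leaf x => [x]
  | node _ l r => leaves l ++ leaves r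

def vars (T : Tr) : List ℕ := T.labels ++ T.leaves

def cnf : Tr → CNF ℕ
  | leaf _ => ∅
  | node p l r => X3 p l.v r.v false ∪ (cnf l ∪ cnf r)

theorem v_mem_vars (T : Tr) : T.v ∈ T.vars := by
  cases T <;> simp [v, vars, labels, leaves]

theorem vars_node (p : ℕ) (l r : Tr) : (node p l r).vars.Perm (p :: (l.vars ++ r.vars)) := by
  simp only [vars, labels, leaves, List.cons_append, List.append_assoc]
  refine List.Perm.cons _ (List.Perm.append_left _ ?_)
  rw [← List.append_assoc, ← List.append_assoc]
  exact List.Perm.append_right _ List.perm_append_comm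

theorem mem_vars_node {x p : ℕ} {l r : Tr} :
    x ∈ (node p l r).vars ↔ x = p ∨ x ∈ l.vars ∨ x ∈ r.vars := by
  rw [(vars_node p l r).mem_iff]; simp

theorem cnfVars_cnf (T : Tr) : ∀ x ∈ cnfVars T.cnf, x ∈ T.vars := by
  induction T with
  | leaf y => rintro x ⟨C, hC, _⟩; simp [cnf] at hC
  | node p l r ihl ihr =>
    intro x hx
    rw [mem_vars_node]
    simp only [cnf, cnfVars_union, cnfVars_X3] at hx
    rcases hx with (rfl | rfl | rfl) | hx | hx
    · exact Or.inl rfl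
    · exact Or.inr (Or.inl (v_mem_vars l))
    · exact Or.inr (Or.inr (v_mem_vars r))
    · exact Or.inr (Or.inl (ihl x hx))
    · exact Or.inr (Or.inr (ihr x hx))

theorem vars_sub (T : Tr) : ∀ x ∈ T.vars, x = T.v ∨ x ∈ cnfVars T.cnf := by
  induction T with
  | leaf y => intro x hx; left; simpa [vars, labels, leaves, v] using hx
  | node p l r ihl ihr =>
    intro x hx
    rw [mem_vars_node] at hx
    simp only [cnf, cnfVars_union, cnfVars_X3, v_node]
    rcases hx with rfl | hx | hx
    · exact Or.inl rfl
    · right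
      rcases ihl x hx with h | h
      · left; rw [h]; simp
      · right; left; exact h
    · right
      rcases ihr x hx with h | h
      · left; rw [h]; simp
      · right; right; exact h

theorem vars_sub_node (p : ℕ) (l r : Tr) :
    ∀ x ∈ (node p l r).vars, x ∈ cnfVars (node p l r).cnf := by
  intro x hx
  rcases vars_sub _ x hx with h | h
  · rw [h]
    simp only [cnf, cnfVars_union, cnfVars_X3, v_node]
    left; simp
  · exact h

end Tr

open Tr

/-- Rewriting of parity trees, counting rotations. -/
inductive Rw : ℕ → Tr → Tr → Prop
  | refl (T : Tr) : Rw 0 T T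
  | trans {a b : ℕ} {T U W : Tr} : Rw a T U → Rw b U W → Rw (a + b) T W
  | symm {a : ℕ} {T U : Tr} : Rw a T U → Rw a U T
  | swap (p : ℕ) (A B : Tr) : Rw 0 (node p A B) (node p B A)
  | rot (p t : ℕ) (A B C : Tr) : Rw 1 (node p (node t A B) C) (node p A (node t B C))
  | left {a : ℕ} (p : ℕ) {L L' : Tr} (R : Tr) : Rw a L L' → Rw a (node p L R) (node p L' R)

theorem Rw.right {a : ℕ} (p : ℕ) (L : Tr) {R R' : Tr} (h : Rw a R R') :
    Rw a (node p L R) (node p L R') := by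
  have := (Rw.swap p L R).trans ((Rw.left p L h).trans (Rw.swap p R' L))
  simpa using this

theorem Rw.v_eq {k : ℕ} {T U : Tr} (h : Rw k T U) : T.v = U.v := by
  induction h with
  | refl => rfl
  | trans _ _ h1 h2 => exact h1.trans h2
  | symm _ h => exact h.symm
  | swap => rfl
  | rot => rfl
  | left => rfl

theorem Rw.labels {k : ℕ} {T U : Tr} (h : Rw k T U) : T.labels.Perm U.labels := by
  induction h with
  | refl => exact .refl _
  | trans _ _ h1 h2 => exact h1.trans h2
  | symm _ h => exact h.symm
  | swap => exact List.Perm.cons _ List.perm_append_comm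
  | rot p t A B C =>
    simp only [Tr.labels, List.cons_append, List.append_assoc]
    exact List.Perm.cons _ List.perm_middle.symm
  | left p R _ ih => exact List.Perm.cons _ (ih.append_right _)

theorem Rw.leaves {k : ℕ} {T U : Tr} (h : Rw k T U) : T.leaves.Perm U.leaves := by
  induction h with
  | refl => exact .refl _
  | trans _ _ h1 h2 => exact h1.trans h2
  | symm _ h => exact h.symm
  | swap => exact List.perm_append_comm
  | rot p t A B C =>
    simp only [Tr.leaves, List.append_assoc]
    exact .refl _
  | left p R _ ih => exact ih.append_right _

theorem Rw.vars {k : ℕ} {T U : Tr} (h : Rw k T U) : T.vars.Perm U.vars :=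
  h.labels.append h.leaves

/-- Conditions under which the tree `T` may be rewritten inside `G ∪ T.cnf`. -/
structure Ok (V : Set ℕ) (G : CNF ℕ) (T : Tr) : Prop where
  nodup : T.vars.Nodup
  fresh : ∀ x ∈ T.labels, x = T.v ∨ x ∉ cnfVars G
  varsG : cnfVars G ⊆ V
  varsT : ∀ x ∈ T.vars, x ∈ V

theorem Ok.rw {V : Set ℕ} {G : CNF ℕ} {k : ℕ} {T U : Tr} (h : Ok V G T) (r : Rw k T U) :
    Ok V G U where
  nodup := r.vars.nodup_iff.1 h.nodup
  fresh := fun x hx => r.v_eq ▸ h.fresh x (r.labels.mem_iff.2 hx)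
  varsG := h.varsG
  varsT := fun x hx => h.varsT x (r.vars.mem_iff.2 hx)

theorem Ok.cnf_sub {V : Set ℕ} {G : CNF ℕ} {T : Tr} (h : Ok V G T) : cnfVars (G ∪ T.cnf) ⊆ V := by
  rw [cnfVars_union]
  exact Set.union_subset h.varsG fun x hx => h.varsT x (cnfVars_cnf T x hx)

theorem labels_sub_vars {T : Tr} {x : ℕ} (h : x ∈ T.labels) : x ∈ T.vars :=
  List.mem_append_left _ h

theorem Rw.der {k : ℕ} {T U : Tr} (h : Rw k T U) : ∀ (V : Set ℕ) (G : CNF ℕ), Ok V G T →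
    Der V (32 * k) (G ∪ T.cnf) (G ∪ U.cnf) := by
  induction h with
  | refl T => intro V G hT; exact Der.refl _ hT.cnf_sub
  | trans r1 _ h1 h2 =>
    intro V G hT
    rw [Nat.mul_add]
    exact (h1 V G hT).trans (h2 V G (hT.rw r1))
  | symm r h => intro V G hT; exact (h V G (hT.rw r.symm)).symm
  | swap p A B =>
    intro V G hT
    have : (node p A B).cnf = (node p B A).cnf := by
      simp only [Tr.cnf]
      rw [X3_swap23, Finset.union_comm A.cnf]
    rw [← this]
    exact Der.refl _ hT.cnf_sub
  | left p R r ih =>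
    rename_i a L L'
    intro V G hT
    have e : ∀ M : Tr, M.v = L.v → G ∪ (node p M R).cnf =
        (G ∪ X3 p L.v R.v false ∪ R.cnf) ∪ M.cnf := by
      intro M hM
      simp only [Tr.cnf]
      rw [hM, Finset.union_comm M.cnf]
      simp only [Finset.union_assoc]
    rw [e L rfl, e L' r.v_eq.symm]
    have nd := (vars_node p L R).nodup_iff.1 hT.nodup
    rw [List.nodup_cons, List.nodup_append, List.mem_append, not_or] at nd
    obtain ⟨⟨hpL, hpR⟩, ndL, ndR, dis⟩ := nd
    apply ih
    refine ⟨ndL, ?_, ?_, ?_⟩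
    · intro x hx
      by_cases hxv : x = L.v
      · exact Or.inl hxv
      right
      have hxL := labels_sub_vars hx
      have hxp : x ≠ p := fun h => hpL (h ▸ hxL)
      rw [cnfVars_union, cnfVars_union, cnfVars_X3]
      rintro ((h | h | h | h) | h)
      · rcases hT.fresh x (List.mem_cons_of_mem _ (List.mem_append_left _ hx)) with h' | h'
        · exact hxp h'
        · exact h' h
      · exact hxp h
      · exact hxv h
      · exact dis x hxL _ (v_mem_vars R) h
      · exact dis x hxL _ (cnfVars_cnf R x h) rfl
    · have := hT.cnf_sub
      rw [e L rfl, cnfVars_union] at this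
      exact Set.subset_union_left.trans this
    · intro x hx
      exact hT.varsT x (mem_vars_node.2 (Or.inr (Or.inl hx)))
  | rot p t A B C =>
    intro V G hT
    have hV := hT.varsT
    have nd := (vars_node p (node t A B) C).nodup_iff.1 hT.nodup
    rw [List.nodup_cons, List.nodup_append, List.mem_append, not_or] at nd
    obtain ⟨⟨hpL, hpR⟩, ndL, ndR, dis⟩ := nd
    have ht : t ∈ (node t A B).vars := mem_vars_node.2 (Or.inl rfl)
    have nd2 := (vars_node t A B).nodup_iff.1 ndL
    rw [List.nodup_cons, List.mem_append, not_or] at nd2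
    obtain ⟨⟨htA, htB⟩, -⟩ := nd2
    have htC : t ∉ C.vars := fun h => dis t ht t h rfl
    have htp : t ≠ p := fun h => hpL (h ▸ ht)
    have htG : t ∉ cnfVars G := by
      rcases hT.fresh t (by simp [Tr.labels]) with h | h
      · exact absurd h htp
      · exact h
    have hA := v_mem_vars A
    have hB := v_mem_vars B
    have hC := v_mem_vars C
    set H : CNF ℕ := G ∪ (A.cnf ∪ (B.cnf ∪ C.cnf)) with hH
    have htH : t ∉ cnfVars H := by
      simp only [hH, cnfVars_union]
      rintro (h | h | h | h)
      · exact htG h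
      · exact htA (cnfVars_cnf _ _ h)
      · exact htB (cnfVars_cnf _ _ h)
      · exact htC (cnfVars_cnf _ _ h)
    have hpV : p ∈ V := hV p (mem_vars_node.2 (Or.inl rfl))
    have hAll : ∀ x, x = t ∨ x ∈ A.vars ∨ x ∈ B.vars ∨ x ∈ C.vars → x ∈ V := by
      intro x hx
      apply hV
      rw [mem_vars_node, mem_vars_node]
      tauto
    have hHV : cnfVars H ⊆ V := by
      simp only [hH, cnfVars_union]
      rintro x (h | h | h | h)
      · exact hT.varsG h
      · exact hAll x (Or.inr (Or.inl (cnfVars_cnf _ _ h)))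
      · exact hAll x (Or.inr (Or.inr (Or.inl (cnfVars_cnf _ _ h))))
      · exact hAll x (Or.inr (Or.inr (Or.inr (cnfVars_cnf _ _ h))))
    have nA : t ≠ A.v := fun h => htA (h ▸ hA)
    have nB : t ≠ B.v := fun h => htB (h ▸ hB)
    have nC : t ≠ C.v := fun h => htC (h ▸ hC)
    have vA : A.v ∈ V := hAll _ (Or.inr (Or.inl hA))
    have vB : B.v ∈ V := hAll _ (Or.inr (Or.inr (Or.inl hB)))
    have vC : C.v ∈ V := hAll _ (Or.inr (Or.inr (Or.inr hC)))
    have vt : t ∈ V := hAll _ (Or.inl rfl)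
    have d1 := Der.intro4 htH nA nB htp nC hHV vA vB hpV vC vt
    have d2 := Der.intro4 htH htp nA nB nC hHV hpV vA vB vC vt
    rw [X4_rot] at d1
    have e1 : G ∪ (node p (node t A B) C).cnf =
        H ∪ (X3 A.v B.v t false ∪ X3 t p C.v false) := by
      simp only [Tr.cnf, hH, v_node]
      rw [X3_swap12 p t, X3_swap12 t A.v, X3_swap23 A.v t]
      ac_rfl
    have e2 : G ∪ (node p A (node t B C)).cnf =
        H ∪ (X3 p A.v t false ∪ X3 t B.v C.v false) := by
      simp only [Tr.cnf, hH, v_node]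
      ac_rfl
    rw [e1, e2]
    exact d1.symm.trans d2

/-! ### Sorting combs -/

/-- `T` is a right comb with leaves `l`. -/
inductive IsComb : Tr → List ℕ → Prop
  | leaf (x : ℕ) : IsComb (leaf x) [x]
  | node (p x : ℕ) {T : Tr} {l : List ℕ} : IsComb T l → IsComb (node p (leaf x) T) (x :: l)

theorem IsComb.leaves {T : Tr} {l : List ℕ} (h : IsComb T l) : T.leaves = l := by
  induction h with
  | leaf x => rfl
  | node p x _ ih => simp [Tr.leaves, ih]

theorem IsComb.ne_nil {T : Tr} {l : List ℕ} (h : IsComb T l) : l ≠ [] := by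
  cases h <;> simp

theorem split_comb (l1 l2 : List ℕ) (h1 : l1 ≠ []) (h2 : l2 ≠ []) :
    ∀ T, IsComb T (l1 ++ l2) → ∃ p L R k, Rw k T (node p L R) ∧ k ≤ l1.length ∧
      IsComb L l1 ∧ IsComb R l2 := by
  induction l1 with
  | nil => exact absurd rfl h1
  | cons x l1 ih =>
    intro T hT
    generalize hl : (x :: l1) ++ l2 = l at hT
    cases hT with
    | leaf y =>
      exfalso
      cases l1 <;> cases l2 <;> simp_all
    | @node p y T l hT =>
      rw [List.cons_append, List.cons.injEq] at hl
      obtain ⟨rfl, rfl⟩ := hl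
      by_cases hn : l1 = []
      · subst hn
        exact ⟨p, _, _, 0, .refl _, by simp, .leaf x, hT⟩
      · obtain ⟨t, L, R, k, hr, hk, hL, hR⟩ := ih hn T hT
        refine ⟨p, node t (leaf x) L, R, k + 1, ?_, by simpa using hk, .node t x hL, hR⟩
        exact (Rw.right p _ hr).trans (Rw.rot p t (leaf x) L R).symm

theorem merge_comb (N : ℕ) : ∀ (p : ℕ) (L R : Tr) (l1 l2 : List ℕ), l1.length + l2.length = N →
    IsComb L l1 → IsComb R l2 → l1.Pairwise (· ≤ ·) → l2.Pairwise (· ≤ ·) →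
    ∃ T l k, Rw k (node p L R) T ∧ k ≤ N ∧ IsComb T l ∧ l.Perm (l1 ++ l2) ∧
      l.Pairwise (· ≤ ·) := by
  induction N with
  | zero =>
    intro p L R l1 l2 hN hL
    exact absurd (List.length_eq_zero_iff.1 (by omega)) hL.ne_nil
  | succ N ih =>
    have main : ∀ (p : ℕ) (L R : Tr) (l1 l2 : List ℕ), l1.length + l2.length = N + 1 →
        IsComb L l1 → IsComb R l2 → l1.Pairwise (· ≤ ·) → l2.Pairwise (· ≤ ·) →
        (∀ x ∈ l1.head?, ∀ y ∈ l2, x ≤ y) →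
        ∃ T l k, Rw k (node p L R) T ∧ k ≤ N + 1 ∧ IsComb T l ∧ l.Perm (l1 ++ l2) ∧
          l.Pairwise (· ≤ ·) := by
      intro p L R l1 l2 hN hL hR s1 s2 hx
      cases hL with
      | leaf x =>
        refine ⟨_, _, 0, .refl _, by omega, .node p x hR, by simp, ?_⟩
        rw [List.pairwise_cons]
        exact ⟨hx x (by simp), s2⟩
      | @node t x L' l1' hL' =>
        rw [List.pairwise_cons] at s1
        obtain ⟨T, l, k, hr, hk, hT, hp, hs⟩ := ih t L' R l1' l2
          (by simp only [List.length_cons] at hN; omega) hL' hR s1.2 s2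
        refine ⟨node p (leaf x) T, x :: l, 1 + k,
          (Rw.rot p t (leaf x) L' R).trans (Rw.right p _ hr), by omega, .node p x hT,
          by simpa using hp, ?_⟩
        rw [List.pairwise_cons]
        refine ⟨fun y hy => ?_, hs⟩
        rcases List.mem_append.1 (hp.mem_iff.1 hy) with h | h
        · exact s1.1 y h
        · exact hx x (by simp) y h
    intro p L R l1 l2 hN hL hR s1 s2
    obtain ⟨x, l1', rfl⟩ := List.exists_cons_of_ne_nil hL.ne_nil
    obtain ⟨y, l2', rfl⟩ := List.exists_cons_of_ne_nil hR.ne_nil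
    rcases le_total x y with h | h
    · apply main p L R _ _ hN hL hR s1 s2
      intro z hz w hw
      simp only [List.head?_cons, Option.mem_def, Option.some.injEq] at hz
      subst hz
      rcases List.mem_cons.1 hw with rfl | hw
      · exact h
      · exact h.trans ((List.pairwise_cons.1 s2).1 w hw)
    · obtain ⟨T, l, k, hr, hk, hT, hp, hs⟩ := main p R L _ _ (by omega) hR hL s2 s1 (by
        intro z hz w hw
        simp only [List.head?_cons, Option.mem_def, Option.some.injEq] at hz
        subst hz
        rcases List.mem_cons.1 hw with rfl | hw
        · exact h
        · exact h.trans ((List.pairwise_cons.1 s1).1 w hw))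
      exact ⟨T, l, 0 + k, (Rw.swap p L R).trans hr, by omega, hT,
        hp.trans List.perm_append_comm, hs⟩

theorem sort_comb (c : ℕ) : ∀ (T : Tr) (l : List ℕ), IsComb T l → l.length ≤ 2 ^ c →
    ∃ T' l' k, Rw k T T' ∧ k ≤ 2 * l.length * c ∧ IsComb T' l' ∧ l'.Perm l ∧
      l'.Pairwise (· ≤ ·) := by
  induction c with
  | zero =>
    intro T l hT hl
    refine ⟨T, l, 0, .refl _, by omega, hT, .refl _, ?_⟩
    cases hT with
    | leaf x => simp
    | node p x h =>
      exfalso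
      have := List.length_pos_of_ne_nil h.ne_nil
      simp at hl
      subst hl
      simp at this
  | succ c ih =>
    intro T l hT hl
    by_cases h1 : l.length ≤ 1
    · obtain ⟨T', l', k, hr, hk, h⟩ := ih T l hT (h1.trans Nat.one_le_two_pow)
      exact ⟨T', l', k, hr, hk.trans (Nat.mul_le_mul_left _ (by omega)), h⟩
    set m := l.length / 2 with hm
    have hl1 : (l.take m).length = m := by rw [List.length_take]; omega
    have hl2 : (l.drop m).length = l.length - m := List.length_drop
    obtain ⟨p, L, R, k0, hr0, hk0, hL, hR⟩ := split_comb (l.take m) (l.drop m)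
      (by intro h; rw [h] at hl1; simp at hl1; omega)
      (by intro h; rw [h] at hl2; simp at hl2; omega) T (by rwa [List.take_append_drop])
    rw [pow_succ] at hl
    obtain ⟨L', a, k1, hr1, hk1, hL', pa, sa⟩ := ih L _ hL (by omega)
    obtain ⟨R', b, k2, hr2, hk2, hR', pb, sb⟩ := ih R _ hR (by omega)
    obtain ⟨U, u, k3, hr3, hk3, hU, pu, su⟩ := merge_comb _ p L' R' a b rfl hL' hR' sa sb
    refine ⟨U, u, k0 + (k1 + (k2 + k3)),
      hr0.trans ((Rw.left p R hr1).trans ((Rw.right p L' hr2).trans hr3)), ?_, hU, ?_, su⟩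
    · rw [pa.length_eq, pb.length_eq, hl1, hl2] at hk3
      rw [hl1] at hk0 hk1
      rw [hl2] at hk2
      have e : m + (l.length - m) = l.length := by omega
      generalize l.length - m = m' at *
      rw [← e]
      nlinarith
    · refine pu.trans ((pa.append pb).trans ?_)
      rw [List.take_append_drop]

/-- Sort a comb including its root. -/
theorem sort_full {V : Set ℕ} {G : CNF ℕ} (c r : ℕ) (T : Tr) (l : List ℕ) (hT : IsComb T l)
    (hv : T.v = r) (hl2 : 2 ≤ l.length) (hc : l.length ≤ 2 ^ c) (ok : Ok V G T) :
    ∃ T' r' l', Der V (128 * l.length * c) (G ∪ T.cnf) (G ∪ T'.cnf) ∧ IsComb T' l' ∧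
      T'.v = r' ∧ (r' :: l').Perm (r :: l) ∧ (r' :: l').Pairwise (· ≤ ·) ∧
      T'.vars.Perm T.vars := by
  obtain ⟨T1, l1, k1, hr1, hk1, hT1, p1, s1⟩ := sort_comb c T l hT hc
  have d1 := hr1.der V G ok
  have ok1 := ok.rw hr1
  have hv1 : T1.v = r := hr1.v_eq ▸ hv
  have hlen : l1.length = l.length := p1.length_eq
  cases hT1 with
  | leaf x => simp at hlen; omega
  | @node p x T2 l2 hT2 =>
    have hpr : p = r := hv1
    subst hpr
    by_cases hle : p ≤ x
    · refine ⟨_, p, _, d1.le ?_, .node p x hT2, rfl, List.Perm.cons _ p1, ?_, hr1.vars.symm⟩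
      · nlinarith
      · rw [List.pairwise_cons]
        refine ⟨fun y hy => ?_, s1⟩
        rcases List.mem_cons.1 hy with rfl | hy
        · exact hle
        · exact hle.trans ((List.pairwise_cons.1 s1).1 y hy)
    · have hsw : (node p (leaf x) T2).vars.Perm (node x (leaf p) T2).vars := by
        refine (vars_node _ _ _).trans (.trans ?_ (vars_node _ _ _).symm)
        simp only [Tr.vars, Tr.labels, Tr.leaves, List.nil_append, List.cons_append]
        exact List.Perm.swap _ _ _
      have ecnf : (node p (leaf x) T2).cnf = (node x (leaf p) T2).cnf := by
        simp only [Tr.cnf, Tr.v]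
        rw [X3_swap12]
      have ok2 : Ok V G (node x (leaf p) T2) := by
        refine ⟨hsw.nodup_iff.1 ok1.nodup, ?_, ok1.varsG, fun y hy => ok1.varsT y (hsw.mem_iff.2 hy)⟩
        intro y hy
        rcases List.mem_cons.1 hy with rfl | hy
        · exact Or.inl rfl
        · right
          have hy' : y ∈ T2.labels := by simpa [Tr.labels] using hy
          rcases ok1.fresh y (List.mem_cons_of_mem _ hy) with h | h
          · exfalso
            have nd := (vars_node _ _ _).nodup_iff.1 ok1.nodup
            rw [List.nodup_cons, List.mem_append, not_or] at nd
            have h' : y = p := h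
            exact nd.1.2 (h' ▸ labels_sub_vars hy')
          · exact h
      have hlen2 : (p :: l2).length = l.length := by simpa using hlen
      obtain ⟨T3, l3, k3, hr3, hk3, hT3, p3, s3⟩ := sort_comb c _ _ (IsComb.node x p hT2)
        (by omega)
      have d3 := hr3.der V G ok2
      rw [← ecnf] at d3
      refine ⟨T3, x, l3, (d1.trans d3).le ?_, hT3, hr3.v_eq.symm, ?_, ?_, ?_⟩
      · rw [hlen2] at hk3
        nlinarith
      · refine (List.Perm.cons _ p3).trans ((List.Perm.swap _ _ _).trans (List.Perm.cons _ p1))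
      · rw [List.pairwise_cons]
        refine ⟨fun y hy => ?_, s3⟩
        rcases List.mem_cons.1 (p3.mem_iff.1 hy) with rfl | hy
        · omega
        · exact (List.pairwise_cons.1 s1).1 y hy
      · exact hr3.vars.symm.trans (hsw.symm.trans hr1.vars.symm)

end RP
namespace RP

/-! ### Clauses over variables and the constant false (`none`) -/

/-- `F` contains a clause subsuming the extended clause `C`, or `C` is trivially true. -/
def HasCl (F : CNF ν) (C : Finset (Option ν × Bool)) : Prop :=
  (∃ l ∈ C, negLit l ∈ C) ∨ (none, false) ∈ C ∨ ∃ D ∈ F, ∀ m ∈ D, (some m.1, m.2) ∈ C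

def UPRe (F : CNF ν) (P : Set (Option ν × Bool)) : Prop :=
  (none, true) ∈ P ∨ UPR F {m | (some m.1, m.2) ∈ P}

theorem HasCl.mono {F G : CNF ν} (h : F ⊆ G) {C : Finset (Option ν × Bool)} (hC : HasCl F C) :
    HasCl G C := by
  rcases hC with h1 | h1 | ⟨D, hD, h1⟩
  · exact Or.inl h1
  · exact Or.inr (Or.inl h1)
  · exact Or.inr (Or.inr ⟨D, h hD, h1⟩)

theorem UPRe.incons {F : CNF ν} {P : Set (Option ν × Bool)} (l : Option ν × Bool) (h : l ∈ P)
    (h' : negLit l ∈ P) : UPRe F P := by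
  obtain ⟨v, b⟩ := l
  cases v with
  | none =>
    left
    cases b
    · exact h'
    · exact h
  | some v => right; exact .incons _ (v, b) h h'

theorem UPRe.conflict {F : CNF ν} {P : Set (Option ν × Bool)} (C : Finset (Option ν × Bool))
    (hC : HasCl F C) (h : ∀ m ∈ C, negLit m ∈ P) : UPRe F P := by
  rcases hC with ⟨l, h1, h2⟩ | h1 | ⟨D, hD, h1⟩
  · refine UPRe.incons (negLit l) (h _ h1) (h _ h2)
  · left; exact h _ h1
  · right
    exact .conflict _ D hD fun m hm => h _ (h1 m hm)

theorem UPRe.unit {F : CNF ν} {P : Set (Option ν × Bool)} (C : Finset (Option ν × Bool))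
    (l : Option ν × Bool) (hC : HasCl F C) (h : ∀ m ∈ C, m = l ∨ negLit m ∈ P)
    (hP : (none, false) ∈ P) (hu : UPRe F (insert l P)) : UPRe F P := by
  by_cases hlP : l ∈ P
  · rwa [Set.insert_eq_of_mem hlP] at hu
  rcases hu with h1 | h1
  · rcases h1 with h1 | h1
    · subst h1
      apply UPRe.conflict C hC
      intro m hm
      rcases h m hm with rfl | h
      · exact hP
      · exact h
    · exact Or.inl h1
  · obtain ⟨v, b⟩ := l
    cases v with
    | none =>
      right
      have : {m : ν × Bool | (some m.1, m.2) ∈ insert ((none : Option ν), b) P} =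
          {m | (some m.1, m.2) ∈ P} := by
        ext m; simp
      rwa [this] at h1
    | some v =>
      rcases hC with ⟨l', h2, h3⟩ | h2 | ⟨D, hD, h2⟩
      · rcases h _ h2 with rfl | h4
        · exfalso
          rcases h _ h3 with h5 | h5
          · exact negLit_ne _ h5
          · exact hlP (by rwa [negLit_negLit] at h5)
        · rcases h _ h3 with h5 | h5
          · exact absurd (h5 ▸ h4) hlP
          · exact UPRe.incons _ h4 h5
      · rcases h _ h2 with h3 | h3
        · simp at h3
        · exact Or.inl h3
      · right
        refine .unit _ D (v, b) hD ?_ ?_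
        · intro m hm
          rcases h _ (h2 m hm) with h3 | h3
          · left
            simp only [Prod.mk.injEq, Option.some.injEq] at h3
            exact Prod.ext h3.1 h3.2
          · right; exact h3
        · have : {m : ν × Bool | (some m.1, m.2) ∈ insert (some v, b) P} =
              insert (v, b) {m | (some m.1, m.2) ∈ P} := by
            ext m
            simp [Prod.ext_iff]
          rwa [this] at h1

/-- The genuine literals of an extended clause. -/
def strip (C : Finset (Option ν × Bool)) : Clause ν :=
  C.biUnion (fun l => match l.1 with
    | none => ∅
    | some v => {(v, l.2)})

theorem mem_strip {C : Finset (Option ν × Bool)} {m : ν × Bool} :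
    m ∈ strip C ↔ (some m.1, m.2) ∈ C := by
  simp only [strip, Finset.mem_biUnion]
  constructor
  · rintro ⟨⟨v, b⟩, hl, hm⟩
    cases v with
    | none => simp at hm
    | some v =>
      simp only [Finset.mem_singleton] at hm
      subst hm
      exact hl
  · intro h
    exact ⟨_, h, by simp⟩

theorem addCls {V : Set ν} {F : CNF ν} (hF : cnfVars F ⊆ V)
    (S : Finset (Finset (Option ν × Bool)))
    (hS : ∀ C ∈ S, UPRe F (insert (none, false) {l | negLit l ∈ C}))
    (hV : ∀ C ∈ S, ∀ v b, (some v, b) ∈ C → v ∈ V) :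
    ∃ F', F ⊆ F' ∧ Der V S.card F F' ∧ ∀ C ∈ S, HasCl F' C := by
  refine ⟨F ∪ (S.filter (fun C => (none, false) ∉ C)).image strip, Finset.subset_union_left,
    (Der.addAT _ _ ?_ ?_).le (Finset.card_image_le.trans (Finset.card_filter_le _ _)), ?_⟩
  · rw [cnfVars_union]
    refine Set.union_subset hF ?_
    rintro v ⟨D, hD, b, hb⟩
    obtain ⟨C, hC, rfl⟩ := Finset.mem_image.1 hD
    exact hV C (Finset.mem_filter.1 hC).1 v b (mem_strip.1 hb)
  · intro D hD
    obtain ⟨C, hC, rfl⟩ := Finset.mem_image.1 hD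
    rw [Finset.mem_filter] at hC
    rcases hS C hC.1 with h | h
    · exfalso
      rcases h with h | h
      · simp at h
      · exact hC.2 h
    · convert h using 1
      ext m
      simp only [Set.mem_ofPred_eq, mem_strip, Set.mem_insert_iff, Prod.mk.injEq, reduceCtorEq,
        false_and, false_or]
      rfl
  · intro C hC
    by_cases h : (none, false) ∈ C
    · exact Or.inr (Or.inl h)
    · right; right
      refine ⟨strip C, ?_, fun m hm => mem_strip.1 hm⟩
      apply Finset.mem_union_right
      exact Finset.mem_image.2 ⟨C, Finset.mem_filter.2 ⟨hC, h⟩, rfl⟩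

/-- `F` contains the clauses of the parity constraint `a ⊕ b ⊕ c = p`. -/
def XH (F : CNF ν) (a b c : Option ν) (p : Bool) : Prop :=
  ∀ i j k, xor i (xor j k) = p → HasCl F {(a, i), (b, j), (c, k)}

theorem XH.mono {F G : CNF ν} (h : F ⊆ G) {a b c : Option ν} {p : Bool} (hx : XH F a b c p) :
    XH G a b c p := fun i j k e => (hx i j k e).mono h

theorem XH.swap12 {F : CNF ν} {a b c : Option ν} {p : Bool} (h : XH F a b c p) :
    XH F b a c p := by
  intro i j k e
  rw [Finset.insert_comm]
  apply h
  rw [← e]; cases i <;> cases j <;> cases k <;> rfl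

theorem XH.swap23 {F : CNF ν} {a b c : Option ν} {p : Bool} (h : XH F a b c p) :
    XH F a c b p := by
  intro i j k e
  rw [Finset.pair_comm]
  apply h
  rw [← e]; cases i <;> cases j <;> cases k <;> rfl

theorem XH.of_X3 {F : CNF ν} {a b c : ν} {p : Bool} (h : X3 a b c p ⊆ F) :
    XH F (some a) (some b) (some c) p := by
  intro i j k e
  refine Or.inr (Or.inr ⟨_, h (mem_X3.2 ⟨i, j, k, e, rfl⟩), ?_⟩)
  intro m hm
  simp only [Finset.mem_insert, Finset.mem_singleton] at hm
  rcases hm with rfl | rfl | rfl <;> simp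

theorem XH.triv (F : CNF ν) (a : Option ν) : XH F none a a false := by
  intro i j k e
  cases i
  · right; left; simp
  · left
    refine ⟨(a, j), by simp, ?_⟩
    revert e
    cases j <;> cases k <;> simp [negLit]

/-- Ext variables all of whose genuine variables lie in `V`. -/
def EV (V : Set ν) (a : Option ν) : Prop := ∀ y, a = some y → y ∈ V

theorem XH.step {V : Set ν} {F : CNF ν} (hF : cnfVars F ⊆ V) {s x s' u u' b : Option ν}
    {p1 p2 p3 : Bool} (h1 : XH F s x s' p1) (h2 : XH F u x u' p2) (h3 : XH F s' b u' p3)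
    (vs : EV V s) (vx : EV V x) (vu : EV V u) (vb : EV V b) :
    ∃ F', F ⊆ F' ∧ Der V 12 F F' ∧ XH F' s b u (xor p1 (xor p2 p3)) := by
  have U1 : ∀ C ∈ (((Finset.univ : Finset (Bool × Bool × Bool × Bool)).filter
      (fun q => xor q.1 (xor q.2.1 q.2.2.1) = xor p1 (xor p2 p3))).image
        (fun q => ({(s, q.1), (b, q.2.1), (u, q.2.2.1), (x, q.2.2.2)} :
          Finset (Option ν × Bool)))), UPRe F (insert (none, false) {l | negLit l ∈ C}) := by
    intro C hC
    obtain ⟨⟨i, j, k, m⟩, hq, rfl⟩ := Finset.mem_image.1 hC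
    have e := (Finset.mem_filter.1 hq).2
    simp only at e
    apply UPRe.unit _ (s', xor i (xor m p1)) (h1 i m (xor i (xor m p1)) (by
      cases i <;> cases m <;> cases p1 <;> rfl))
    · intro y hy
      simp only [Finset.mem_insert, Finset.mem_singleton] at hy
      rcases hy with rfl | rfl | rfl <;> simp [negLit_negLit]
    · simp
    generalize hn : xor i (xor m p1) = n
    apply UPRe.unit _ (u', xor (!n) (xor j p3)) (h3 (!n) j (xor (!n) (xor j p3)) (by
      cases n <;> cases j <;> cases p3 <;> rfl))
    · intro y hy
      simp only [Finset.mem_insert, Finset.mem_singleton] at hy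
      rcases hy with rfl | rfl | rfl
      · right; left; simp [negLit]
      · right; right; right; simp [negLit_negLit]
      · left; rfl
    · right; left; rfl
    apply UPRe.conflict _ (h2 k m (!(xor (!n) (xor j p3))) ?_)
    · intro y hy
      simp only [Finset.mem_insert, Finset.mem_singleton] at hy
      rcases hy with rfl | rfl | rfl
      · right; right; right; simp [negLit_negLit]
      · right; right; right; simp [negLit_negLit]
      · left; simp [negLit]
    · subst hn
      revert e
      cases i <;> cases j <;> cases k <;> cases m <;> cases p1 <;> cases p2 <;> cases p3 <;> decide
  obtain ⟨F1, hF1, d1, hc1⟩ := addCls hF _ U1 (by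
    intro C hC v c hv
    obtain ⟨⟨i, j, k, m⟩, hq, rfl⟩ := Finset.mem_image.1 hC
    simp only [Finset.mem_insert, Finset.mem_singleton, Prod.mk.injEq] at hv
    rcases hv with h | h | h | h
    · exact vs v h.1.symm
    · exact vb v h.1.symm
    · exact vu v h.1.symm
    · exact vx v h.1.symm)
  have U2 : ∀ C ∈ (((Finset.univ : Finset (Bool × Bool × Bool)).filter
      (fun q => xor q.1 (xor q.2.1 q.2.2) = xor p1 (xor p2 p3))).image
        (fun q => ({(s, q.1), (b, q.2.1), (u, q.2.2)} : Finset (Option ν × Bool)))),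
      UPRe F1 (insert (none, false) {l | negLit l ∈ C}) := by
    intro C hC
    obtain ⟨⟨i, j, k⟩, hq, rfl⟩ := Finset.mem_image.1 hC
    have e := (Finset.mem_filter.1 hq).2
    have hm : ∀ m, HasCl F1 {(s, i), (b, j), (u, k), (x, m)} := fun m => hc1 _
      (Finset.mem_image.2 ⟨(i, j, k, m), Finset.mem_filter.2 ⟨Finset.mem_univ _, e⟩, rfl⟩)
    apply UPRe.unit _ (x, true) (hm true)
    · intro y hy
      simp only [Finset.mem_insert, Finset.mem_singleton] at hy
      rcases hy with rfl | rfl | rfl | rfl <;> simp [negLit_negLit]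
    · simp
    · apply UPRe.conflict _ (hm false)
      intro y hy
      simp only [Finset.mem_insert, Finset.mem_singleton] at hy
      rcases hy with rfl | rfl | rfl | rfl
      · right; right; simp [negLit_negLit]
      · right; right; simp [negLit_negLit]
      · right; right; simp [negLit_negLit]
      · left; simp [negLit]
  obtain ⟨F2, hF2, d2, hc2⟩ := addCls d1.vars_right _ U2 (by
    intro C hC v c hv
    obtain ⟨⟨i, j, k⟩, hq, rfl⟩ := Finset.mem_image.1 hC
    simp only [Finset.mem_insert, Finset.mem_singleton, Prod.mk.injEq] at hv
    rcases hv with h | h | h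
    · exact vs v h.1.symm
    · exact vb v h.1.symm
    · exact vu v h.1.symm)
  refine ⟨F2, hF1.trans hF2, (d1.trans d2).le ?_, ?_⟩
  · refine (Nat.add_le_add Finset.card_image_le Finset.card_image_le).trans ?_
    generalize xor p1 (xor p2 p3) = p
    revert p
    decide
  · intro i j k e
    apply hc2
    exact Finset.mem_image.2 ⟨(i, j, k), Finset.mem_filter.2 ⟨Finset.mem_univ _, e⟩, rfl⟩

/-- The value of `v` is the parity of the list plus a constant, encoded in `F` as a chain. -/
inductive PChain (V : Set ν) (F : CNF ν) : Option ν → List ν → Bool → Prop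
  | nil : PChain V F none [] false
  | cons {v v' : Option ν} {x : ν} {l : List ν} {p c : Bool} : XH F v (some x) v' p → EV V v →
      x ∈ V → PChain V F v' l c → PChain V F v (x :: l) (xor p c)

theorem PChain.ev {V : Set ν} {F : CNF ν} {v : Option ν} {l : List ν} {c : Bool}
    (h : PChain V F v l c) : EV V v := by
  cases h with
  | nil => intro y hy; simp at hy
  | cons _ h _ _ => exact h

theorem PChain.one {V : Set ν} {F : CNF ν} {x : ν} (hx : x ∈ V) :
    PChain V F (some x) [x] false := by
  have h := PChain.cons (p := false) (XH.triv F (some x)).swap12.swap23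
    (fun y hy => by simp only [Option.some.injEq] at hy; exact hy ▸ hx) hx (PChain.nil (V := V))
  simpa using h

theorem PChain.root {V : Set ν} {F : CNF ν} {x : ν} {l : List ν} {c : Bool}
    (h : PChain V F (some x) l c) : PChain V F none (x :: l) c := by
  have h := PChain.cons (p := false) (XH.triv F (some x)) (fun y hy => by simp at hy)
    (h.ev x rfl) h
  simpa using h

/-- Symmetric difference of lists in a common order. -/
inductive SD : List ν → List ν → List ν → Prop
  | nil : SD [] [] []
  | left (x : ν) {a b c : List ν} : SD a b c → SD (x :: a) b (x :: c)
  | right (x : ν) {a b c : List ν} : SD a b c → SD a (x :: b) (x :: c)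
  | both (x : ν) {a b c : List ν} : SD a b c → SD (x :: a) (x :: b) c

theorem SD.filter {α : Type} (f : α → ν) (p q r : α → Bool) (h : ∀ x, r x = xor (p x) (q x))
    (l : List α) : SD ((l.filter p).map f) ((l.filter q).map f) ((l.filter r).map f) := by
  induction l with
  | nil => exact .nil
  | cons x l ih =>
    have := h x
    cases hp : p x <;> cases hq : q x <;> rw [hp, hq] at this <;> simp at this <;>
      simp only [List.filter_cons, hp, hq, this, List.map_cons, if_true, Bool.false_eq_true, if_false]
    · exact ih
    · exact .right _ ih
    · exact .left _ ih
    · exact .both _ ih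

theorem SD.derive {V : Set ν} {la lb lc : List ν} (h : SD la lb lc) : ∀ (F : CNF ν)
    (va vb vc : Option ν) (ca cb cc : Bool), cnfVars F ⊆ V → PChain V F va la ca →
    PChain V F vb lb cb → PChain V F vc lc cc →
    ∃ F', F ⊆ F' ∧ Der V (12 * (la.length + lb.length)) F F' ∧
      XH F' va vb vc (xor ca (xor cb cc)) := by
  induction h with
  | nil =>
    intro F va vb vc ca cb cc hF ha hb hc
    cases ha; cases hb; cases hc
    exact ⟨F, Finset.Subset.refl _, Der.refl _ hF, XH.triv F none⟩
  | left x _ ih =>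
    intro F va vb vc ca cb cc hF ha hb hc
    cases ha with
    | cons xa ea hx ha =>
    cases hc with
    | cons xc ec _ hc =>
    obtain ⟨F1, hF1, d1, h1⟩ := ih F _ _ _ _ _ _ hF ha hb hc
    obtain ⟨F2, hF2, d2, h2⟩ := XH.step d1.vars_right (xa.mono hF1) (xc.mono hF1) h1 ea
      (fun y hy => by simp only [Option.some.injEq] at hy; exact hy ▸ hx) ec hb.ev
    refine ⟨F2, hF1.trans hF2, (d1.trans d2).le (by simp only [List.length_cons]; omega), ?_⟩
    convert h2 using 1
    simp only [Bool.xor_assoc, Bool.xor_left_comm]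
  | right x _ ih =>
    intro F va vb vc ca cb cc hF ha hb hc
    cases hb with
    | cons xa ea hx hb =>
    cases hc with
    | cons xc ec _ hc =>
    obtain ⟨F1, hF1, d1, h1⟩ := ih F _ _ _ _ _ _ hF ha hb hc
    obtain ⟨F2, hF2, d2, h2⟩ := XH.step d1.vars_right (xa.mono hF1) (xc.mono hF1) h1.swap12 ea
      (fun y hy => by simp only [Option.some.injEq] at hy; exact hy ▸ hx) ec ha.ev
    refine ⟨F2, hF1.trans hF2, (d1.trans d2).le (by simp only [List.length_cons]; omega), ?_⟩
    convert h2.swap12 using 1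
    simp only [Bool.xor_assoc, Bool.xor_left_comm]
  | both x _ ih =>
    intro F va vb vc ca cb cc hF ha hb hc
    cases ha with
    | cons xa ea hx ha =>
    cases hb with
    | cons xb eb _ hb =>
    obtain ⟨F1, hF1, d1, h1⟩ := ih F _ _ _ _ _ _ hF ha hb hc
    obtain ⟨F2, hF2, d2, h2⟩ := XH.step d1.vars_right (xa.mono hF1) (xb.mono hF1) h1.swap23 ea
      (fun y hy => by simp only [Option.some.injEq] at hy; exact hy ▸ hx) eb hc.ev
    refine ⟨F2, hF1.trans hF2, (d1.trans d2).le (by simp only [List.length_cons]; omega), ?_⟩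
    convert h2.swap23 using 1
    simp only [Bool.xor_assoc, Bool.xor_left_comm]

theorem XH.empty {F : CNF ν} (h : XH F none none none true) : (∅ : Clause ν) ∈ F := by
  rcases h true true true rfl with ⟨l, h1, h2⟩ | h1 | ⟨D, hD, h1⟩
  · exfalso
    simp only [Finset.mem_insert, Finset.mem_singleton, or_self] at h1 h2
    subst h1
    simp [negLit] at h2
  · simp at h1
  · have : D = ∅ := by
      rw [Finset.eq_empty_iff_forall_notMem]
      intro m hm
      simpa using h1 m hm
    exact this ▸ hD

theorem IsComb.chain {V : Set ℕ} {F : CNF ℕ} {T : Tr} {l : List ℕ} (h : IsComb T l) :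
    T.cnf ⊆ F → (∀ x ∈ T.vars, x ∈ V) → PChain V F (some T.v) l false := by
  induction h with
  | leaf x => intro _ hV; exact PChain.one (hV _ (Tr.v_mem_vars (Tr.leaf x)))
  | @node p x T l _ ih =>
    intro hF hV
    have h1 : X3 p x T.v false ⊆ F := Finset.subset_union_left.trans hF
    have h2 : T.cnf ⊆ F := (Finset.subset_union_right.trans Finset.subset_union_right).trans hF
    have := PChain.cons (XH.of_X3 h1) (fun y hy => ?_) ?_
      (ih h2 fun y hy => hV y (Tr.mem_vars_node.2 (Or.inr (Or.inr hy))))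
    · simpa [Tr.v_node] using this
    · simp only [Option.some.injEq] at hy
      exact hV y (Tr.mem_vars_node.2 (Or.inl hy.symm))
    · exact hV x (Tr.mem_vars_node.2 (Or.inr (Or.inl (Tr.v_mem_vars (Tr.leaf x)))))

end RP
namespace RP

/-! ### Translation of the linear encoding -/

theorem odd3 : ∀ a b c : Bool,
    ((Finset.univ.filter (fun i : Fin 3 => (![a, b, c] : Fin 3 → Bool) i = true)).card % 2 = 1) ↔
      xor a (xor b c) = true := by decide

theorem xorCNF3 (a b c : ν) (sa sb sc : Bool) :
    xorCNF [(a, sa), (b, sb), (c, sc)] = X3 a b c (!(xor sa (xor sb sc))) := by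
  ext C
  rw [mem_X3]
  unfold xorCNF parityCNF
  simp only [Finset.mem_image, Finset.mem_filter, Finset.mem_univ, true_and]
  constructor
  · rintro ⟨f, hf, rfl⟩
    change Fin 3 → Bool at f
    obtain ⟨x, y, z, rfl⟩ : ∃ x y z, f = ![x, y, z] :=
      ⟨f 0, f 1, f 2, by ext i; fin_cases i <;> rfl⟩
    have h := (odd3 x y z).1 (by simpa using hf)
    refine ⟨xor sa x, xor sb y, xor sc z, ?_, ?_⟩
    · clear hf; revert h; revert sa sb sc x y z; decide
    · have hu : (Finset.univ : Finset (Fin 3)) = {0, 1, 2} := by decide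
      change Finset.image _ (Finset.univ : Finset (Fin 3)) = _
      rw [hu]
      simp only [Finset.image_insert, Finset.image_singleton]
      cases x <;> cases y <;> cases z <;> simp [negLit]
  · rintro ⟨i, j, k, h, rfl⟩
    refine ⟨(![xor sa i, xor sb j, xor sc k] : Fin 3 → Bool), ?_, ?_⟩
    · have := (odd3 (xor sa i) (xor sb j) (xor sc k)).2
        (by revert h; revert sa sb sc i j k; decide)
      simpa using this
    · have hu : (Finset.univ : Finset (Fin 3)) = {0, 1, 2} := by decide
      change Finset.image _ (Finset.univ : Finset (Fin 3)) = _
      rw [hu]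
      simp only [Finset.image_insert, Finset.image_singleton]
      cases sa <;> cases sb <;> cases sc <;> cases i <;> cases j <;> cases k <;>
        simp [negLit]

/-- The right-comb with labels `lab j, lab (j+1), …` and leaves `g j, g (j+1), …`. -/
def bld (g lab : ℕ → ℕ) : ℕ → ℕ → Tr
  | 0, j => Tr.leaf (g j)
  | k + 1, j => Tr.node (lab j) (Tr.leaf (g j)) (bld g lab k (j + 1))

def nx (g lab : ℕ → ℕ) (M i : ℕ) : ℕ := if i = M then g i else lab i

theorem bld_v (g lab : ℕ → ℕ) (k j : ℕ) : (bld g lab k j).v = nx g lab (j + k) j := by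
  cases k <;> simp [bld, nx, Tr.v]

theorem bld_comb (g lab : ℕ → ℕ) (k : ℕ) : ∀ j,
    IsComb (bld g lab k j) ((List.range' j (k + 1)).map g) := by
  induction k with
  | zero => intro j; exact IsComb.leaf _
  | succ k ih =>
    intro j
    rw [List.range'_succ, List.map_cons]
    exact IsComb.node _ _ (ih (j + 1))

theorem bld_labels (g lab : ℕ → ℕ) (k : ℕ) : ∀ j,
    (bld g lab k j).labels = (List.range' j k).map lab := by
  induction k with
  | zero => intro j; rfl
  | succ k ih =>
    intro j
    simp [bld, Tr.labels, ih, List.range'_succ]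

theorem bld_leaves (g lab : ℕ → ℕ) (k : ℕ) : ∀ j,
    (bld g lab k j).leaves = (List.range' j (k + 1)).map g := by
  induction k with
  | zero => intro j; rfl
  | succ k ih =>
    intro j
    rw [List.range'_succ, List.map_cons, ← ih]
    simp [bld, Tr.leaves]

theorem bld_cnf (g lab : ℕ → ℕ) (M k : ℕ) : ∀ j, j + k = M → ∀ C,
    (C ∈ (bld g lab k j).cnf ↔
      ∃ i, j ≤ i ∧ i < M ∧ C ∈ X3 (lab i) (g i) (nx g lab M (i + 1)) false) := by
  induction k with
  | zero => intro j hj C; simp [bld, Tr.cnf]; omega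
  | succ k ih =>
    intro j hj C
    have e : j + 1 + k = M := by omega
    simp only [bld, Tr.cnf, Finset.mem_union, Tr.v_leaf, bld_v, e, ih (j + 1) e]
    simp only [Finset.notMem_empty, false_or]
    constructor
    · rintro (h | ⟨i, h1, h2, h⟩)
      · exact ⟨j, le_rfl, by omega, h⟩
      · exact ⟨i, by omega, h2, h⟩
    · rintro ⟨i, h1, h2, h⟩
      rcases Nat.lt_or_ge j i with h3 | h3
      · exact Or.inr ⟨i, h3, h2, h⟩
      · obtain rfl : i = j := by omega
        exact Or.inl h

def gf (xs : List (Lit ℕ)) (i : ℕ) : ℕ := (xs.getD (i + 1) (0, true)).1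

def lf (xs : List (Lit ℕ)) (t : ℕ → ℕ) (i : ℕ) : ℕ :=
  if i = 0 then (xs.getD 0 (0, true)).1 else t (i - 1)

theorem ctr_eq (xs : List (Lit ℕ)) (t : ℕ → ℕ) (p : Bool) (h4 : 4 ≤ xs.length)
    (hs : ∀ i (h : i < xs.length), xs[i].2 = if i + 1 = xs.length then !p else true)
    (i : ℕ) (hi : i < xs.length - 2) :
    xorCNF (parityCtr xs t i) = X3 (lf xs t i) (gf xs i)
      (nx (gf xs) (lf xs t) (xs.length - 2) (i + 1))
      (if i + 1 = xs.length - 2 then p else false) := by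
  have key : ∀ j (h : j < xs.length) (d : Lit ℕ), xs.getD j d =
      ((xs.getD j (0, true)).1, if j + 1 = xs.length then !p else true) := by
    intro j h d
    rw [← hs j h]
    simp [List.getD, h]
  unfold parityCtr
  split_ifs with h0 h1
  · omega
  · subst h0
    rw [key 0 (by omega), key 1 (by omega), if_neg (by omega), if_neg (by omega), xorCNF3]
    simp only [lf, gf, nx, if_neg h1]
    simp
  · omega
  · rw [key (i + 1) (by omega), if_neg (by omega), xorCNF3]
    simp only [lf, gf, nx, if_neg (show ¬ i + 1 = xs.length - 2 by omega), if_neg h0]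
    simp
  · have e : xs.length = i + 3 := by omega
    rw [key (xs.length - 2) (by omega), key (xs.length - 1) (by omega), if_neg (by omega),
      if_pos (by omega), xorCNF3]
    simp only [lf, gf, nx, if_neg h0, e]
    simp
  · omega

theorem mem_ParityCNF (xs : List (Lit ℕ)) (t : ℕ → ℕ) (p : Bool) (h4 : 4 ≤ xs.length)
    (hs : ∀ i (h : i < xs.length), xs[i].2 = if i + 1 = xs.length then !p else true)
    (C : Clause ℕ) : C ∈ ParityCNF xs t ↔ ∃ i, i < xs.length - 2 ∧ C ∈ X3 (lf xs t i) (gf xs i)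
      (nx (gf xs) (lf xs t) (xs.length - 2) (i + 1))
      (if i + 1 = xs.length - 2 then p else false) := by
  unfold ParityCNF
  simp only [Finset.mem_biUnion, Finset.mem_range]
  constructor
  · rintro ⟨i, hi, h⟩
    exact ⟨i, hi, by rwa [ctr_eq xs t p h4 hs i hi] at h⟩
  · rintro ⟨i, hi, h⟩
    exact ⟨i, hi, by rwa [ctr_eq xs t p h4 hs i hi]⟩

theorem list_eq (xs : List (Lit ℕ)) (t : ℕ → ℕ) (h4 : 4 ≤ xs.length) :
    xs.map Prod.fst = lf xs t 0 :: (List.range' 0 (xs.length - 2 + 1)).map (gf xs) := by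
  apply List.ext_getElem
  · simp; omega
  · intro i h1 h2
    cases i with
    | zero =>
      simp only [List.length_map] at h1
      simp [lf, List.getD, h1]
    | succ i =>
      simp only [List.length_map] at h1
      simp [gf, List.getD, h1]

theorem A_tree (lv : List ℕ) (t : ℕ → ℕ) (h4 : 4 ≤ lv.length) :
    ∃ T r l, lv = r :: l ∧ IsComb T l ∧ T.v = r ∧
      T.cnf = ParityCNF (lv.map (fun x => (x, true))) t ∧
      T.labels = r :: (List.range (lv.length - 3)).map t ∧ T.leaves = l ∧
      ∀ x ∈ T.vars, x ∈ cnfVars T.cnf := by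
  set xs : List (Lit ℕ) := lv.map (fun x => (x, true)) with hxs
  have hl : xs.length = lv.length := by simp [hxs]
  have hm : xs.map Prod.fst = lv := by simp [hxs, Function.comp_def]
  obtain ⟨k, hk⟩ : ∃ k, lv.length - 2 = k + 1 := ⟨lv.length - 3, by omega⟩
  refine ⟨bld (gf xs) (lf xs t) (k + 1) 0, lf xs t 0,
    (List.range' 0 (k + 1 + 1)).map (gf xs), ?_, bld_comb _ _ _ _, ?_, ?_, ?_,
    bld_leaves _ _ _ _, ?_⟩
  · rw [← hk, ← hl, ← list_eq xs t (by omega), hm]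
  · rfl
  · ext C
    rw [mem_ParityCNF xs t false (by omega), bld_cnf _ _ (xs.length - 2) (k + 1) 0 (by omega)]
    · simp
    · intro i h
      simp [hxs]
  · rw [bld_labels, List.range'_succ, List.map_cons]
    have : lv.length - 3 = k := by omega
    rw [this]
    congr 1
    apply List.ext_getElem
    · simp
    · intro i h1 h2
      simp [lf]
  · exact Tr.vars_sub_node _ _ _

theorem C_chain_aux (V : Set ℕ) (F : CNF ℕ) (g lab : ℕ → ℕ) (M : ℕ)
    (hX : ∀ i < M, X3 (lab i) (g i) (nx g lab M (i + 1)) (if i + 1 = M then true else false) ⊆ F)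
    (hM : 0 < M) (hV : cnfVars F ⊆ V) (k : ℕ) : ∀ j, j + k = M →
    PChain V F (some (nx g lab M j)) ((List.range' j (k + 1)).map g) (decide (k ≠ 0)) := by
  have hv : ∀ i < M, lab i ∈ V ∧ g i ∈ V ∧ nx g lab M (i + 1) ∈ V := by
    intro i hi
    have h := (cnfVars_mono (hX i hi)).trans hV
    rw [cnfVars_X3] at h
    exact ⟨h (by simp), h (by simp), h (by simp)⟩
  induction k with
  | zero =>
    intro j hj
    obtain rfl : j = M := by omega
    have := (hv (j - 1) (by omega)).2.2
    rw [Nat.sub_add_cancel hM] at this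
    have e : nx g lab j j = g j := by simp [nx]
    rw [e] at this ⊢
    exact PChain.one this
  | succ k ih =>
    intro j hj
    have hjM : j < M := by omega
    have e : nx g lab M j = lab j := by simp [nx]; omega
    have h := PChain.cons (XH.of_X3 (hX j hjM))
      (fun y hy => by cases hy; exact (hv j hjM).1) (hv j hjM).2.1 (ih (j + 1) (by omega))
    rw [e, List.range'_succ, List.map_cons]
    convert h using 1
    by_cases hk : k = 0
    · have : j + 1 = M := by omega
      simp [hk, this]
    · have : j + 1 ≠ M := by omega
      simp [hk, this]

theorem C_chain (xs : List (Lit ℕ)) (t : ℕ → ℕ) (h4 : 4 ≤ xs.length)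
    (hs : ∀ i (h : i < xs.length), xs[i].2 = if i + 1 = xs.length then !true else true)
    (V : Set ℕ) (F : CNF ℕ) (hF : ParityCNF xs t ⊆ F) (hV : cnfVars F ⊆ V) :
    PChain V F none (xs.map Prod.fst) true := by
  rw [list_eq xs t h4]
  apply PChain.root
  have := C_chain_aux V F (gf xs) (lf xs t) (xs.length - 2) (fun i hi C hC =>
    hF ((mem_ParityCNF xs t true h4 hs C).2 ⟨i, hi, hC⟩)) (by omega) hV (xs.length - 2) 0 (by omega)
  have e : nx (gf xs) (lf xs t) (xs.length - 2) 0 = lf xs t 0 := by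
    rw [nx, if_neg (by omega)]
  have e2 : decide (xs.length - 2 ≠ 0) = true := by simp; omega
  rwa [e, e2] at this

theorem C_vars (xs : List (Lit ℕ)) (t : ℕ → ℕ) (p : Bool) (h4 : 4 ≤ xs.length)
    (hs : ∀ i (h : i < xs.length), xs[i].2 = if i + 1 = xs.length then !p else true) :
    ∀ x ∈ cnfVars (ParityCNF xs t), x ∈ xs.map Prod.fst ∨ ∃ i, x = t i := by
  rintro x ⟨C, hC, hx⟩
  obtain ⟨i, hi, hC⟩ := (mem_ParityCNF xs t p h4 hs C).1 hC
  have hx' : x ∈ cnfVars (X3 (lf xs t i) (gf xs i)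
      (nx (gf xs) (lf xs t) (xs.length - 2) (i + 1))
      (if i + 1 = xs.length - 2 then p else false)) := ⟨C, hC, hx⟩
  rw [cnfVars_X3] at hx'
  have hg : ∀ j < xs.length - 1, gf xs j ∈ xs.map Prod.fst := by
    intro j hj
    rw [list_eq xs t h4]
    refine List.mem_cons_of_mem _ (List.mem_map.2 ⟨j, ?_, rfl⟩)
    simp; omega
  have hl : ∀ j, lf xs t j ∈ xs.map Prod.fst ∨ ∃ i, lf xs t j = t i := by
    intro j
    by_cases hj : j = 0
    · subst hj; left; rw [list_eq xs t h4]; exact List.mem_cons_self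
    · right; exact ⟨j - 1, by simp [lf, hj]⟩
  rcases hx' with rfl | rfl | rfl
  · exact hl i
  · exact Or.inl (hg i (by omega))
  · unfold nx
    split_ifs with h
    · exact Or.inl (hg _ (by omega))
    · exact hl _

end RP
namespace RP

/-! ### Final assembly -/

/-- The elements of `A` in increasing order, as natural numbers. -/
def inc {n : ℕ} (A : Finset (Fin n)) : List ℕ :=
  ((List.finRange n).filter (fun i => decide (i ∈ A))).map (fun i : Fin n => (i : ℕ))

theorem inc_sorted {n : ℕ} (A : Finset (Fin n)) : (inc A).Pairwise (· < ·) := by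
  unfold inc
  rw [List.pairwise_map]
  exact ((List.pairwise_lt_finRange n).filter _).imp (fun h => h)

theorem inc_lt {n : ℕ} (A : Finset (Fin n)) : ∀ x ∈ inc A, x < n := by
  intro x hx
  obtain ⟨i, _, rfl⟩ := List.mem_map.1 hx
  exact i.2

theorem filter_length {n : ℕ} (A : Finset (Fin n)) :
    ((List.finRange n).filter (fun i => decide (i ∈ A))).length = A.card := by
  rw [← List.toFinset_card_of_nodup ((List.nodup_finRange n).filter _)]
  congr 1
  ext i
  simp

theorem inc_length {n : ℕ} (A : Finset (Fin n)) : (inc A).length = A.card := by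
  rw [inc, List.length_map, filter_length]

theorem card_le {n : ℕ} (A : Finset (Fin n)) : A.card ≤ n := by
  simpa using Finset.card_le_univ A

theorem ordered_perm {n : ℕ} (A : Finset (Fin n)) (σ : Equiv.Perm (Fin n)) :
    ((orderedElems A σ).map (fun i : Fin n => (i : ℕ))).Perm (inc A) := by
  unfold orderedElems inc
  refine List.Perm.map _ (List.Perm.filter _ ?_)
  rw [List.perm_ext_iff_of_nodup (List.nodup_ofFn.2 σ.injective) (List.nodup_finRange n)]
  intro a
  simp only [List.mem_ofFn, List.mem_finRange, iff_true]
  exact σ.surjective a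

theorem ordered_refl {n : ℕ} (A : Finset (Fin n)) :
    orderedElems A (Equiv.refl (Fin n)) = (List.finRange n).filter (fun i => decide (i ∈ A)) := by
  unfold orderedElems
  congr 1

theorem posLits_eq {n : ℕ} (l : List (Fin n)) :
    posLits l = (l.map (fun i : Fin n => (i : ℕ))).map (fun x => (x, true)) := by
  unfold posLits
  congr 1
  induction l with
  | nil => rfl
  | cons a l ih =>
    rw [List.map_cons, ← ih]
    rfl

theorem tree_side {n : ℕ} (A : Finset (Fin n)) (σ : Equiv.Perm (Fin n)) (h4 : 4 ≤ A.card)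
    (off : ℕ) (hoff : n ≤ off) :
    ∃ T r l, IsComb T l ∧ T.v = r ∧ (r :: l).Perm (inc A) ∧
      T.cnf = ParityCNF (posLits (orderedElems A σ)) (fun k => off + k) ∧ T.vars.Nodup ∧
      (∀ x ∈ T.labels, x = T.v ∨ (off ≤ x ∧ x < off + n)) ∧
      (∀ x ∈ T.vars, x < n ∨ (off ≤ x ∧ x < off + n)) ∧ ∀ x ∈ T.vars, x ∈ cnfVars T.cnf := by
  set lv := (orderedElems A σ).map (fun i : Fin n => (i : ℕ)) with hlv
  have hp : lv.Perm (inc A) := ordered_perm A σ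
  have hlen : lv.length = A.card := by rw [hp.length_eq, inc_length]
  have hcard := card_le A
  obtain ⟨T, r, l, he, hT, hr, hc, hlab, hlea, hv⟩ := A_tree lv (fun k => off + k) (by omega)
  have hpos : posLits (orderedElems A σ) = lv.map (fun x => (x, true)) := by
    rw [hlv, posLits_eq]
  have hlt : ∀ x ∈ lv, x < n := fun x hx => inc_lt A x (hp.mem_iff.1 hx)
  have hlabs : ∀ x ∈ (List.range (lv.length - 3)).map (fun k => off + k),
      off ≤ x ∧ x < off + n := by
    intro x hx
    obtain ⟨k, hk, rfl⟩ := List.mem_map.1 hx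
    rw [List.mem_range] at hk
    constructor <;> omega
  have hperm : T.vars.Perm (lv ++ (List.range (lv.length - 3)).map (fun k => off + k)) := by
    rw [Tr.vars, hlab, hlea, he]
    simp only [List.cons_append]
    exact List.Perm.cons _ List.perm_append_comm
  refine ⟨T, r, l, hT, hr, he ▸ hp, by rw [hc, hpos], ?_, ?_, ?_, hv⟩
  · rw [hperm.nodup_iff, List.nodup_append]
    refine ⟨?_, ?_, ?_⟩
    · rw [hp.nodup_iff]
      exact (inc_sorted A).imp (fun h => Nat.ne_of_lt h)
    · exact List.nodup_range.map (fun a b h => by simpa using h)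
    · intro a ha b hb hab
      have := hlt a ha
      have := hlabs b hb
      omega
  · intro x hx
    rw [hlab, List.mem_cons] at hx
    rcases hx with h | h
    · left; rw [h, hr]
    · right; exact hlabs x h
  · intro x hx
    rw [hperm.mem_iff, List.mem_append] at hx
    rcases hx with h | h
    · left; exact hlt x h
    · right; exact hlabs x h

theorem symm_fst {n : ℕ} (A B : Finset (Fin n)) :
    (symmLits A B (Equiv.refl (Fin n))).map Prod.fst = inc (symmDiff A B) := by
  simp [symmLits, ordered_refl, inc, Function.comp_def]

theorem symm_length {n : ℕ} (A B : Finset (Fin n)) :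
    (symmLits A B (Equiv.refl (Fin n))).length = (symmDiff A B).card := by
  rw [← inc_length, ← symm_fst, List.length_map]

theorem symm_sign {n : ℕ} (A B : Finset (Fin n)) (i : ℕ)
    (h : i < (symmLits A B (Equiv.refl (Fin n))).length) :
    (symmLits A B (Equiv.refl (Fin n)))[i].2 =
      if i + 1 = (symmLits A B (Equiv.refl (Fin n))).length then !true else true := by
  set D := symmDiff A B with hD
  have hL := filter_length D
  set L := (List.finRange n).filter (fun i => decide (i ∈ D)) with hLd
  have hlen := symm_length A B
  rw [← hD, ← hL] at hlen
  have hs : L.Pairwise (· < ·) := (List.pairwise_lt_finRange n).filter _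
  have hmem : ∀ x, x ∈ L ↔ x ∈ D := by intro x; simp [hLd]
  have hi : i < L.length := by omega
  have hmax : D.max = ((L[L.length - 1]'(by omega) : Fin n) : WithBot (Fin n)) := by
    apply le_antisymm
    · apply Finset.max_le
      intro a ha
      obtain ⟨j, hj, rfl⟩ := List.getElem_of_mem ((hmem a).2 ha)
      rw [WithBot.coe_le_coe]
      rcases Nat.lt_or_ge j (L.length - 1) with hlt | hge
      · exact (List.pairwise_iff_getElem.1 hs j (L.length - 1) hj (by omega) hlt).le
      · have : j = L.length - 1 := by omega
        subst this
        exact le_rfl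
    · exact Finset.le_max ((hmem _).1 (List.getElem_mem _))
  have hval : (symmLits A B (Equiv.refl (Fin n)))[i].2 =
      decide (((L[i] : Fin n) : WithBot (Fin n)) ≠ D.max) := by
    simp [symmLits, ordered_refl, ← hD, hLd]
  rw [hval, hmax, hlen]
  rcases Nat.lt_or_ge i (L.length - 1) with hlt | hge
  · have := List.pairwise_iff_getElem.1 hs i (L.length - 1) hi (by omega) hlt
    rw [if_neg (by omega)]
    simp only [ne_eq, WithBot.coe_inj, decide_eq_true_eq]
    exact this.ne
  · have : i = L.length - 1 := by omega
    subst this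
    rw [if_pos (by omega)]
    simp

theorem sorted_unique {l : List ℕ} {n : ℕ} {A : Finset (Fin n)} (hp : l.Perm (inc A))
    (hs : l.Pairwise (· ≤ ·)) : l = inc A :=
  List.Perm.eq_of_pairwise' hs ((inc_sorted A).imp (fun h => Nat.le_of_lt h)) hp

theorem main_der (n : ℕ) (A B : Finset (Fin n)) (hA : 4 ≤ A.card) (hB : 4 ≤ B.card)
    (hC : 4 ≤ (symmDiff A B).card) (σa σb : Equiv.Perm (Fin n)) :
    ∃ G, Der (cnfVars (rAddPar n A B σa σb (Equiv.refl (Fin n))))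
      (256 * n * (Nat.log 2 n + 1) + 24 * n) (rAddPar n A B σa σb (Equiv.refl (Fin n))) G ∧
      (∅ : Clause ℕ) ∈ G := by
  have hcA := card_le A
  have hcB := card_le B
  obtain ⟨TA, ra, la, combA, vA, permA, cnfA, ndA, labA, varA, subA⟩ :=
    tree_side A σa hA n le_rfl
  obtain ⟨TB, rb, lb, combB, vB, permB, cnfB, ndB, labB, varB, subB⟩ :=
    tree_side B σb hB (2 * n) (by omega)
  have hsign := symm_sign A B
  have hfst := symm_fst A B
  have hslen := symm_length A B
  unfold rAddPar
  rw [← cnfA, ← cnfB]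
  set xs := symmLits A B (Equiv.refl (Fin n)) with hxs
  set CC := ParityCNF xs (fun k => 3 * n + k) with hCC
  set F0 := TA.cnf ∪ TB.cnf ∪ CC with hF0
  set V := cnfVars F0 with hV
  have hVe : V = cnfVars TA.cnf ∪ cnfVars TB.cnf ∪ cnfVars CC := by
    rw [hV, hF0, cnfVars_union, cnfVars_union]
  have varC : ∀ x ∈ cnfVars CC, x < n ∨ 3 * n ≤ x := by
    intro x hx
    rcases C_vars xs _ true (by omega) hsign x hx with h | ⟨i, h⟩
    · left; rw [hfst] at h; exact inc_lt _ x h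
    · right; rw [h]; omega
  have hTAV : ∀ x ∈ TA.vars, x ∈ V := fun x hx => by
    rw [hVe]; exact Or.inl (Or.inl (subA x hx))
  have hTBV : ∀ x ∈ TB.vars, x ∈ V := fun x hx => by
    rw [hVe]; exact Or.inl (Or.inr (subB x hx))
  have hCCV : cnfVars CC ⊆ V := by rw [hVe]; exact fun x hx => Or.inr hx
  have hlA : la.length + 1 = A.card := by
    rw [← inc_length, ← permA.length_eq]; rfl
  have hlB : lb.length + 1 = B.card := by
    rw [← inc_length, ← permB.length_eq]; rfl
  have hpow : n < 2 ^ (Nat.log 2 n + 1) := Nat.lt_pow_succ_log_self (by norm_num) n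
  set c := Nat.log 2 n + 1 with hc
  have okA : Ok V (TB.cnf ∪ CC) TA :=
    { nodup := ndA
      fresh := by
        intro x hx
        rcases labA x hx with h | h
        · exact Or.inl h
        · right
          rw [cnfVars_union]
          rintro (h' | h')
          · have := varB x (Tr.cnfVars_cnf TB x h'); omega
          · have := varC x h'; omega
      varsG := by
        rw [cnfVars_union, hVe]
        rintro x (h | h)
        · exact Or.inl (Or.inr h)
        · exact Or.inr h
      varsT := hTAV }
  obtain ⟨TA', ra', la', dA, combA', vA', permA', sortA', pvA⟩ :=
    sort_full c ra TA la combA vA (by omega) (by omega) okA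
  have hTAV' : ∀ x ∈ TA'.vars, x ∈ V := fun x hx => hTAV x (pvA.mem_iff.1 hx)
  have okB : Ok V (TA'.cnf ∪ CC) TB :=
    { nodup := ndB
      fresh := by
        intro x hx
        rcases labB x hx with h | h
        · exact Or.inl h
        · right
          rw [cnfVars_union]
          rintro (h' | h')
          · have := varA x (pvA.mem_iff.1 (Tr.cnfVars_cnf TA' x h')); omega
          · have := varC x h'; omega
      varsG := by
        rw [cnfVars_union]
        rintro x (h | h)
        · exact hTAV' x (Tr.cnfVars_cnf TA' x h)
        · exact hCCV h
      varsT := hTBV }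
  obtain ⟨TB', rb', lb', dB, combB', vB', permB', sortB', pvB⟩ :=
    sort_full c rb TB lb combB vB (by omega) (by omega) okB
  have hTBV' : ∀ x ∈ TB'.vars, x ∈ V := fun x hx => hTBV x (pvB.mem_iff.1 hx)
  have e1 : TB.cnf ∪ CC ∪ TA.cnf = F0 := by
    rw [hF0]; ext D; simp only [Finset.mem_union]; tauto
  have e2 : TB.cnf ∪ CC ∪ TA'.cnf = TA'.cnf ∪ CC ∪ TB.cnf := by
    ext D; simp only [Finset.mem_union]; tauto
  rw [e1, e2] at dA
  have d := dA.trans dB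
  set F1 := TA'.cnf ∪ CC ∪ TB'.cnf with hF1
  have hF1V : cnfVars F1 ⊆ V := d.vars_right
  have chA : PChain V F1 none (inc A) false := by
    rw [← sorted_unique (permA'.trans permA) sortA']
    refine PChain.root ?_
    rw [← vA']
    exact combA'.chain (fun D hD => by simp only [hF1, Finset.mem_union]; tauto) hTAV'
  have chB : PChain V F1 none (inc B) false := by
    rw [← sorted_unique (permB'.trans permB) sortB']
    refine PChain.root ?_
    rw [← vB']
    exact combB'.chain (fun D hD => by simp only [hF1, Finset.mem_union]; tauto) hTBV'
  have chC : PChain V F1 none (inc (symmDiff A B)) true := by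
    rw [← hfst]
    exact C_chain xs _ (by omega) hsign V F1
      (fun D hD => by simp only [hF1, Finset.mem_union]; tauto) hF1V
  have hSD : SD (inc A) (inc B) (inc (symmDiff A B)) := by
    refine SD.filter (fun i : Fin n => (i : ℕ)) _ _ _ ?_ _
    intro x
    by_cases h1 : x ∈ A <;> by_cases h2 : x ∈ B <;> simp [Finset.mem_symmDiff, h1, h2]
  obtain ⟨F2, _, d2, hX⟩ := hSD.derive F1 none none none _ _ _ hF1V chA chB chC
  refine ⟨F2, (d.trans d2).le ?_, XH.empty (by simpa using hX)⟩
  rw [inc_length, inc_length]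
  have b1 : 128 * la.length * c ≤ 128 * n * c := by gcongr; omega
  have b2 : 128 * lb.length * c ≤ 128 * n * c := by gcongr; omega
  have b3 : 256 * n * c = 128 * n * c + 128 * n * c := by ring
  omega

theorem log_bound (n : ℕ) (hn : 4 ≤ n) :
    ((256 * n * (Nat.log 2 n + 1) + 24 * n : ℕ) : ℝ) ≤ 1000 * n * Real.log n := by
  have h2 : (0.6931471803 : ℝ) < Real.log 2 := Real.log_two_gt_d9
  have hn0 : (4 : ℝ) ≤ n := by exact_mod_cast hn
  have h1 : (Nat.log 2 n : ℝ) * Real.log 2 ≤ Real.log n := by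
    rw [← Real.log_pow]
    apply Real.log_le_log (by positivity)
    exact_mod_cast Nat.pow_log_le_self 2 (by omega)
  have h3 : 2 * Real.log 2 ≤ Real.log n := by
    have : Real.log ((2 : ℝ) ^ 2) ≤ Real.log n :=
      Real.log_le_log (by positivity) (by norm_num; exact hn)
    rwa [Real.log_pow] at this
  have h4 : (Nat.log 2 n : ℝ) ≤ 1.5 * Real.log n := by
    have : (0 : ℝ) ≤ (Nat.log 2 n : ℝ) := by positivity
    nlinarith
  have h5 : 256 * ((Nat.log 2 n : ℝ) + 1) + 24 ≤ 1000 * Real.log n := by linarith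
  push_cast
  have h6 := mul_le_mul_of_nonneg_left h5 (show (0 : ℝ) ≤ n by positivity)
  linarith

end RP
/-- There is a constant `K` such that for every `n`, all
`A, B ⊆ {x_1,…,x_n}` with `|A| ≥ 4`, `|B| ≥ 4`, `|A △ B| ≥ 4` and all orderings `σa`
of `A` and `σb` of `B`, the formula `rAddPar(a, b)` has a DRAT⁻ refutation (using no
variables other than those of the formula) with at most `K·n·log n` lines. -/
theorem rAddPar_short_drat_refutation :
    ∃ K : ℝ, ∀ (n : ℕ) (A B : Finset (Fin n)),
      4 ≤ A.card → 4 ≤ B.card → 4 ≤ (symmDiff A B).card →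
      ∀ σa σb : Equiv.Perm (Fin n),
        ∃ Fs : List (CNF ℕ),
          IsDRATRefutation (rAddPar n A B σa σb (Equiv.refl (Fin n))) Fs ∧
          NoNewVars (rAddPar n A B σa σb (Equiv.refl (Fin n))) Fs ∧
          (Fs.length : ℝ) - 1 ≤ K * n * Real.log n := by
  refine ⟨1000, ?_⟩
  intro n A B hA hB hC σa σb
  obtain ⟨G, hd, hG⟩ := RP.main_der n A B hA hB hC σa σb
  obtain ⟨Fs, h1, h2, h3, h4, h5, h6⟩ := hd.toList
  refine ⟨Fs, ⟨h1, h2, h3, G, h4, hG⟩, h5, ?_⟩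
  have hn : 4 ≤ n := hA.trans (RP.card_le A)
  have h7 : (Fs.length : ℝ) ≤
      ((256 * n * (Nat.log 2 n + 1) + 24 * n : ℕ) : ℝ) + 1 := by exact_mod_cast h6
  have h8 := RP.log_bound n hn
  linarith
end

section
/- There is a constant K such that for every n, all A, B ⊆ X = {x_1,…,x_n} with |A| ≥ 4, |B| ≥ 4 and |A△B| ≥ 4, and all orderings σ_a of A and σ_b of B, the formula rAddPar(a,b) has an extended resolution refutation with at most K·n·log n lines. -/
variable {ν : Type} [DecidableEq ν]

/-- One of the four clauses (indexed by `b1 b2 : Bool`) of the extension definition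
`v ↔ g(l1, l2)` for a Boolean function `g` of two literals `l1, l2`: the clause ruling
out the assignments where `l1` has value `b1`, `l2` has value `b2`, and `v ≠ g b1 b2`. -/
def defClause (g : Bool → Bool → Bool) (v : ν) (l1 l2 : Lit ν) (b1 b2 : Bool) : Clause ν :=
  {(l1.1, xor l1.2 b1), (l2.1, xor l2.2 b2), (v, g b1 b2)}

/-- An extended resolution derivation from `F`: every clause is a clause of `F`, a
resolvent of two earlier clauses, or an extension clause defining a fresh variable `v`
as a fixed Boolean function `g` of two previously occurring literals (all earlier
occurrences of `v` being among the defining clauses of the same definition). -/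
def IsERDeriv (F : CNF ν) (L : List (Clause ν)) : Prop :=
  ∀ i, (hi : i < L.length) →
    L[i] ∈ F ∨
    (∃ j k, ∃ (hj : j < i) (hk : k < i),
      IsResolvent (L[j]'(hj.trans hi)) (L[k]'(hk.trans hi)) L[i]) ∨
    (∃ (g : Bool → Bool → Bool) (v : ν) (l1 l2 : Lit ν),
      v ∉ cnfVars F ∧ l1.1 ≠ v ∧ l2.1 ≠ v ∧
      (l1.1 ∈ cnfVars F ∨ ∃ j, ∃ (hj : j < i), l1.1 ∈ clauseVars (L[j]'(hj.trans hi))) ∧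
      (l2.1 ∈ cnfVars F ∨ ∃ j, ∃ (hj : j < i), l2.1 ∈ clauseVars (L[j]'(hj.trans hi))) ∧
      (∀ j, (hj : j < i) → v ∈ clauseVars (L[j]'(hj.trans hi)) →
        ∃ b1 b2, L[j]'(hj.trans hi) = defClause g v l1 l2 b1 b2) ∧
      ∃ b1 b2, L[i] = defClause g v l1 l2 b1 b2)

/-- An extended resolution refutation of `F`: an extended resolution derivation ending
with the empty clause; its number of lines is `L.length`. -/
def IsERRefutation (F : CNF ν) (L : List (Clause ν)) : Prop :=
  IsERDeriv F L ∧ L.getLast? = some (∅ : Clause ν)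

/-! ### Extended resolution derivations up to subsumption -/

/-- Some clause of `F` or `L` subsumes `C`. -/
def Subs (F : CNF ℕ) (L : List (Clause ℕ)) (C : Clause ℕ) : Prop :=
  ∃ D, (D ∈ F ∨ D ∈ L) ∧ D ⊆ C

/-- The clause over `V` falsified by `τ`. -/
def falsClause (V : Finset ℕ) (τ : ℕ → Bool) : Clause ℕ := V.image (fun v => (v, !τ v))

/-- The predicate `P` is encoded by the available clauses over the variables `V`. -/
def Ent (F : CNF ℕ) (L : List (Clause ℕ)) (V : Finset ℕ) (P : (ℕ → Bool) → Prop) : Prop :=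
  ∀ τ, ¬ P τ → Subs F L (falsClause V τ)

/-- The variable `x` occurs in `F` or `L`. -/
def Occurs (F : CNF ℕ) (L : List (Clause ℕ)) (x : ℕ) : Prop :=
  x ∈ cnfVars F ∨ ∃ C ∈ L, x ∈ clauseVars C

/-- The second list is a derivation containing `L` with at most `c` more lines. -/
def ExtBy (F : CNF ℕ) (L : List (Clause ℕ)) (c : ℕ) (L' : List (Clause ℕ)) : Prop :=
  IsERDeriv F L' ∧ L ⊆ L' ∧ L'.length ≤ L.length + c

/-- Value of a literal. -/
def litVal (τ : ℕ → Bool) (l : Lit ℕ) : Bool := τ l.1 == l.2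

/-- Parity of a list of literals. -/
def parVal (τ : ℕ → Bool) : List (Lit ℕ) → Bool
  | [] => false
  | l :: ls => litVal τ l ^^ parVal τ ls

theorem ExtBy.trans {F : CNF ℕ} {L L' L'' : List (Clause ℕ)} {c d : ℕ}
    (h : ExtBy F L c L') (h' : ExtBy F L' d L'') : ExtBy F L (c + d) L'' :=
  ⟨h'.1, fun _ hx => h'.2.1 (h.2.1 hx), by have := h.2.2; have := h'.2.2; omega⟩

theorem ExtBy.mono {F : CNF ℕ} {L L' : List (Clause ℕ)} {c d : ℕ}
    (h : ExtBy F L c L') (hcd : c ≤ d) : ExtBy F L d L' :=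
  ⟨h.1, h.2.1, by have := h.2.2; omega⟩

theorem ExtBy.same {F : CNF ℕ} {L : List (Clause ℕ)} {c : ℕ}
    (h : IsERDeriv F L) : ExtBy F L c L :=
  ⟨h, fun _ hx => hx, by omega⟩

theorem Subs.mono {F : CNF ℕ} {L L' : List (Clause ℕ)} {C : Clause ℕ}
    (h : Subs F L C) (hL : L ⊆ L') : Subs F L' C := by
  obtain ⟨D, hD, hs⟩ := h
  exact ⟨D, hD.imp id (fun h => hL h), hs⟩

theorem Ent.mono {F : CNF ℕ} {L L' : List (Clause ℕ)} {V : Finset ℕ} {P : (ℕ → Bool) → Prop}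
    (h : Ent F L V P) (hL : L ⊆ L') : Ent F L' V P := fun τ hτ => (h τ hτ).mono hL

theorem Occurs.mono {F : CNF ℕ} {L L' : List (Clause ℕ)} {x : ℕ}
    (h : Occurs F L x) (hL : L ⊆ L') : Occurs F L' x :=
  h.imp id (fun ⟨C, hC, hx⟩ => ⟨C, hL hC, hx⟩)

theorem Ent.weak {F : CNF ℕ} {L : List (Clause ℕ)} {V W : Finset ℕ} {P Q : (ℕ → Bool) → Prop}
    (h : Ent F L V P) (hV : V ⊆ W) (hPQ : ∀ τ, P τ → Q τ) : Ent F L W Q := by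
  intro τ hτ
  obtain ⟨D, hD, hs⟩ := h τ (fun hp => hτ (hPQ τ hp))
  exact ⟨D, hD, hs.trans (Finset.image_subset_image hV)⟩

theorem Ent.and {F : CNF ℕ} {L : List (Clause ℕ)} {V W : Finset ℕ} {P Q : (ℕ → Bool) → Prop}
    (h : Ent F L V P) (h' : Ent F L W Q) : Ent F L (V ∪ W) (fun τ => P τ ∧ Q τ) := by
  intro τ hτ
  by_cases hp : P τ
  · have hq : ¬ Q τ := fun hq => hτ ⟨hp, hq⟩
    exact (h'.weak Finset.subset_union_right (fun _ h => h)) τ hq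
  · exact (h.weak Finset.subset_union_left (fun _ h => h)) τ hp

/-! ### Appending lines -/

theorem er_snoc {F : CNF ℕ} {L : List (Clause ℕ)} {C : Clause ℕ} (hL : IsERDeriv F L)
    (h : C ∈ F ∨ (∃ D ∈ L, ∃ E ∈ L, IsResolvent D E C) ∨
      (∃ (g : Bool → Bool → Bool) (v : ℕ) (l1 l2 : Lit ℕ),
        v ∉ cnfVars F ∧ l1.1 ≠ v ∧ l2.1 ≠ v ∧ Occurs F L l1.1 ∧ Occurs F L l2.1 ∧
        (∀ D ∈ L, v ∈ clauseVars D → ∃ b1 b2, D = defClause g v l1 l2 b1 b2) ∧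
        ∃ b1 b2, C = defClause g v l1 l2 b1 b2)) :
    IsERDeriv F (L ++ [C]) := by
  intro i hi
  by_cases hlt : i < L.length
  · have e : (L ++ [C])[i] = L[i] := List.getElem_append_left hlt
    have e' : ∀ j (hj : j < i), (L ++ [C])[j]'(hj.trans hi) = L[j]'(hj.trans hlt) :=
      fun j hj => List.getElem_append_left (hj.trans hlt)
    rw [e]
    rcases hL i hlt with h1 | ⟨j, k, hj, hk, h1⟩ | ⟨g, v, l1, l2, h1, h2, h3, h4, h5, h6, h7⟩
    · exact Or.inl h1
    · refine Or.inr (Or.inl ⟨j, k, hj, hk, ?_⟩)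
      rw [e' j hj, e' k hk]; exact h1
    · refine Or.inr (Or.inr ⟨g, v, l1, l2, h1, h2, h3, ?_, ?_, ?_, h7⟩)
      · exact h4.imp id (fun ⟨j, hj, hh⟩ => ⟨j, hj, by rw [e' j hj]; exact hh⟩)
      · exact h5.imp id (fun ⟨j, hj, hh⟩ => ⟨j, hj, by rw [e' j hj]; exact hh⟩)
      · intro j hj hv
        rw [e' j hj] at hv ⊢
        exact h6 j hj hv
  · have hil : i = L.length := by simp at hi; omega
    subst hil
    have e : (L ++ [C])[L.length] = C := by simp
    have e' : ∀ j (hj : j < L.length), (L ++ [C])[j]'(hj.trans hi) = L[j] :=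
      fun j hj => List.getElem_append_left hj
    rw [e]
    have occ : ∀ x, Occurs F L x → (x ∈ cnfVars F ∨ ∃ j, ∃ (hj : j < L.length),
        x ∈ clauseVars ((L ++ [C])[j]'(hj.trans hi))) := by
      intro x hx
      refine hx.imp id ?_
      rintro ⟨D, hD, hh⟩
      obtain ⟨j, hj, rfl⟩ := List.mem_iff_getElem.1 hD
      exact ⟨j, hj, by rw [e' j hj]; exact hh⟩
    rcases h with h1 | ⟨D, hD, E, hE, h1⟩ | ⟨g, v, l1, l2, h1, h2, h3, h4, h5, h6, h7⟩
    · exact Or.inl h1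
    · obtain ⟨j, hj, rfl⟩ := List.mem_iff_getElem.1 hD
      obtain ⟨k, hk, rfl⟩ := List.mem_iff_getElem.1 hE
      refine Or.inr (Or.inl ⟨j, k, hj, hk, ?_⟩)
      rw [e' j hj, e' k hk]; exact h1
    · refine Or.inr (Or.inr ⟨g, v, l1, l2, h1, h2, h3, occ _ h4, occ _ h5, ?_, h7⟩)
      intro j hj hv
      rw [e' j hj] at hv ⊢
      exact h6 _ (List.getElem_mem _) hv

theorem er_avail {F : CNF ℕ} {L : List (Clause ℕ)} {D : Clause ℕ} (hL : IsERDeriv F L)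
    (h : D ∈ F ∨ D ∈ L) : ∃ L', ExtBy F L 1 L' ∧ D ∈ L' := by
  rcases h with h | h
  · exact ⟨L ++ [D], ⟨er_snoc hL (Or.inl h), by simp, by simp⟩, by simp⟩
  · exact ⟨L, ExtBy.same hL, h⟩

theorem resolve_one {F : CNF ℕ} {L : List (Clause ℕ)} {C : Clause ℕ} {x : ℕ}
    (hL : IsERDeriv F L) (h1 : Subs F L (insert (x, true) C))
    (h2 : Subs F L (insert (x, false) C)) : ∃ L', ExtBy F L 3 L' ∧ Subs F L' C := by
  obtain ⟨D, hD, hDs⟩ := h1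
  obtain ⟨E, hE, hEs⟩ := h2
  by_cases hx : (x, true) ∈ D
  · by_cases hy : (x, false) ∈ E
    · obtain ⟨L1, hL1, hD1⟩ := er_avail hL hD
      obtain ⟨L2, hL2, hE2⟩ := er_avail hL1.1 (hE.imp id (fun h => hL1.2.1 h))
      have hL3 : ExtBy F L2 1 (L2 ++ [D.erase (x, true) ∪ E.erase (x, false)]) := by
        refine ⟨er_snoc hL2.1 (Or.inr (Or.inl ⟨D, hL2.2.1 hD1, E, hE2, x, hx, hy, rfl⟩)),
          by simp, by simp⟩
      refine ⟨_, (hL1.trans hL2).trans hL3, D.erase (x, true) ∪ E.erase (x, false),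
        Or.inr (by simp), ?_⟩
      apply Finset.union_subset
      · exact Finset.subset_insert_iff.1 hDs
      · exact Finset.subset_insert_iff.1 hEs
    · exact ⟨L, ExtBy.same hL, E, hE, (Finset.subset_insert_iff_of_notMem hy).1 hEs⟩
  · exact ⟨L, ExtBy.same hL, D, hD, (Finset.subset_insert_iff_of_notMem hx).1 hDs⟩

theorem resolve_many {F : CNF ℕ} {x : ℕ} (Cs : List (Clause ℕ)) :
    ∀ {L : List (Clause ℕ)}, IsERDeriv F L →
    (∀ C ∈ Cs, Subs F L (insert (x, true) C) ∧ Subs F L (insert (x, false) C)) →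
    ∃ L', ExtBy F L (3 * Cs.length) L' ∧ ∀ C ∈ Cs, Subs F L' C := by
  induction Cs with
  | nil => intro L hL _; exact ⟨L, ExtBy.same hL, by simp⟩
  | cons C Cs ih =>
    intro L hL h
    obtain ⟨L1, h1, hC⟩ := resolve_one hL (h C (by simp)).1 (h C (by simp)).2
    obtain ⟨L2, h2, hCs⟩ := ih h1.1 (fun D hD =>
      ⟨(h D (by simp [hD])).1.mono h1.2.1, (h D (by simp [hD])).2.mono h1.2.1⟩)
    refine ⟨L2, (h1.trans h2).mono (by simp; omega), ?_⟩
    intro D hD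
    rcases List.mem_cons.1 hD with rfl | hD
    · exact hC.mono h2.2.1
    · exact hCs D hD

theorem falsClause_congr {V : Finset ℕ} {τ τ' : ℕ → Bool} (h : ∀ v ∈ V, τ v = τ' v) :
    falsClause V τ = falsClause V τ' := by
  apply Finset.image_congr
  intro v hv
  simp [h v hv]

theorem falsClause_insert {V : Finset ℕ} {τ : ℕ → Bool} {x : ℕ} :
    falsClause (insert x V) τ = insert (x, !τ x) (falsClause V τ) := by
  simp [falsClause, Finset.image_insert]

open Classical in
theorem elim_one {F : CNF ℕ} {L : List (Clause ℕ)} {V : Finset ℕ} {x : ℕ}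
    {Q : (ℕ → Bool) → Prop} (hL : IsERDeriv F L) (hx : x ∉ V) (h : Ent F L (insert x V) Q)
    (hQ : ∀ τ b, Q (Function.update τ x b) → Q τ) :
    ∃ L', ExtBy F L (3 * 2 ^ V.card) L' ∧ Ent F L' V Q := by
  let Cs : List (Clause ℕ) := (((V.powerset.image (fun s => falsClause V (fun v => decide (v ∈ s)))).filter
    (fun C => Subs F L (insert (x, true) C) ∧ Subs F L (insert (x, false) C)))).toList
  obtain ⟨L', h1, h2⟩ := resolve_many (F := F) (x := x) Cs hL (by
    intro C hC
    simp only [Cs, Finset.mem_toList, Finset.mem_filter] at hC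
    exact hC.2)
  refine ⟨L', h1.mono ?_, ?_⟩
  · simp only [Cs, Finset.length_toList]
    have := (Finset.card_filter_le (V.powerset.image (fun s => falsClause V (fun v => decide (v ∈ s))))
      (fun C => Subs F L (insert (x, true) C) ∧ Subs F L (insert (x, false) C))).trans Finset.card_image_le
    rw [Finset.card_powerset] at this
    omega
  · intro τ hτ
    apply h2
    simp only [Cs, Finset.mem_toList, Finset.mem_filter, Finset.mem_image, Finset.mem_powerset]
    refine ⟨⟨V.filter (fun v => τ v = true), Finset.filter_subset _ _, ?_⟩, ?_⟩
    · apply falsClause_congr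
      intro v hv
      simp [hv]
    · have key : ∀ b, Subs F L (insert (x, !b) (falsClause V τ)) := by
        intro b
        have := h (Function.update τ x b) (fun hq => hτ (hQ τ b hq))
        rw [falsClause_insert] at this
        have e : falsClause V (Function.update τ x b) = falsClause V τ := by
          apply falsClause_congr
          intro v hv
          rw [Function.update_of_ne]
          rintro rfl; exact hx hv
        rw [e] at this
        simpa using this
      exact ⟨key false, key true⟩

theorem elim_set {F : CNF ℕ} {W : Finset ℕ} {Q : (ℕ → Bool) → Prop}
    (hQ : ∀ τ τ', (∀ v ∈ W, τ v = τ' v) → Q τ → Q τ') (U : Finset ℕ) :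
    ∀ {L : List (Clause ℕ)}, IsERDeriv F L → Ent F L (W ∪ U) Q →
    ∃ L', ExtBy F L (3 * 2 ^ (W ∪ U).card) L' ∧ Ent F L' W Q := by
  induction U using Finset.induction_on with
  | empty => intro L hL h; exact ⟨L, ExtBy.same hL, by simpa using h⟩
  | insert x U hxU ih =>
    intro L hL h
    by_cases hxW : x ∈ W
    · have e : W ∪ insert x U = W ∪ U := by
        ext v; simp only [Finset.mem_union, Finset.mem_insert]
        constructor
        · rintro (h | rfl | h) <;> tauto
        · tauto
      rw [e] at h ⊢
      exact ih hL h
    · have hx : x ∉ W ∪ U := by simp [hxW, hxU]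
      have e : W ∪ insert x U = insert x (W ∪ U) := by simp [Finset.union_insert]
      rw [e] at h ⊢
      obtain ⟨L1, h1, hE⟩ := elim_one hL hx h (fun τ b => hQ _ _ (by
        intro v hv
        rw [Function.update_of_ne]
        rintro rfl; exact hxW hv))
      obtain ⟨L2, h2, hE2⟩ := ih h1.1 hE
      refine ⟨L2, (h1.trans h2).mono ?_, hE2⟩
      rw [Finset.card_insert_of_notMem hx, pow_succ]
      omega

/-- Constant-size derivation of any consequence over at most six variables. -/
theorem derive {F : CNF ℕ} {L : List (Clause ℕ)} {V W : Finset ℕ} {P Q : (ℕ → Bool) → Prop}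
    (hL : IsERDeriv F L) (h : Ent F L V P) (hPQ : ∀ τ, P τ → Q τ) (hV : (W ∪ V).card ≤ 6)
    (hQ : ∀ τ τ', (∀ v ∈ W, τ v = τ' v) → Q τ → Q τ') :
    ∃ L', ExtBy F L 192 L' ∧ Ent F L' W Q := by
  obtain ⟨L', h1, h2⟩ := elim_set hQ V hL (h.weak Finset.subset_union_right hPQ)
  refine ⟨L', h1.mono ?_, h2⟩
  have := Nat.pow_le_pow_right (n := 2) (by norm_num) hV
  omega

theorem exists_fresh (F : CNF ℕ) (L : List (Clause ℕ)) : ∃ v, ¬ Occurs F L v := by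
  obtain ⟨v, hv⟩ := Infinite.exists_notMem_finset
    (((F ∪ L.toFinset).biUnion id).image Prod.fst)
  refine ⟨v, fun h => hv ?_⟩
  simp only [Finset.mem_image, Finset.mem_biUnion, Finset.mem_union, List.mem_toFinset, id]
  rcases h with ⟨C, hC, b, hb⟩ | ⟨C, hC, b, hb⟩
  · exact ⟨(v, b), ⟨C, Or.inl hC, hb⟩, rfl⟩
  · exact ⟨(v, b), ⟨C, Or.inr hC, hb⟩, rfl⟩

theorem extend_var {F : CNF ℕ} {L : List (Clause ℕ)} (g : Bool → Bool → Bool) (l1 l2 : Lit ℕ)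
    (hL : IsERDeriv F L) (h1 : Occurs F L l1.1) (h2 : Occurs F L l2.1) :
    ∃ L' v, ExtBy F L 4 L' ∧ Occurs F L' v ∧
      Ent F L' {l1.1, l2.1, v} (fun τ => τ v = g (litVal τ l1) (litVal τ l2)) := by
  obtain ⟨v, hv⟩ := exists_fresh F L
  have hvF : v ∉ cnfVars F := fun h => hv (Or.inl h)
  have hvL : ∀ D ∈ L, v ∉ clauseVars D := fun D hD h => hv (Or.inr ⟨D, hD, h⟩)
  have hn1 : l1.1 ≠ v := by rintro rfl; exact hv h1
  have hn2 : l2.1 ≠ v := by rintro rfl; exact hv h2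
  have key : ∀ Bs : List (Bool × Bool),
      ExtBy F L Bs.length (L ++ Bs.map (fun b => defClause g v l1 l2 b.1 b.2)) := by
    intro Bs
    induction Bs using List.reverseRecOn with
    | nil => simpa using ExtBy.same hL
    | append_singleton Bs b ih =>
      refine ⟨?_, by simp, by simp⟩
      rw [List.map_append, ← List.append_assoc]
      refine er_snoc ih.1 (Or.inr (Or.inr ⟨g, v, l1, l2, hvF, hn1, hn2, h1.mono ih.2.1,
        h2.mono ih.2.1, ?_, b.1, b.2, rfl⟩))
      intro D hD hvD
      rcases List.mem_append.1 hD with hD | hD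
      · exact absurd hvD (hvL D hD)
      · obtain ⟨b', _, rfl⟩ := List.mem_map.1 hD
        exact ⟨b'.1, b'.2, rfl⟩
  refine ⟨_, v, key [(false, false), (false, true), (true, false), (true, true)], ?_, ?_⟩
  · refine Or.inr ⟨defClause g v l1 l2 false false, by simp, g false false, ?_⟩
    simp [defClause]
  · intro τ hτ
    refine ⟨defClause g v l1 l2 (litVal τ l1) (litVal τ l2), Or.inr ?_, ?_⟩
    · rcases litVal τ l1 <;> rcases litVal τ l2 <;> simp
    · intro l hl
      simp only [defClause, Finset.mem_insert, Finset.mem_singleton] at hl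
      simp only [falsClause, Finset.mem_image, Finset.mem_insert, Finset.mem_singleton]
      rcases hl with rfl | rfl | rfl
      · refine ⟨l1.1, Or.inl rfl, ?_⟩
        simp only [litVal, Prod.mk.injEq, true_and]
        rcases τ l1.1 <;> rcases l1.2 <;> rfl
      · refine ⟨l2.1, Or.inr (Or.inl rfl), ?_⟩
        simp only [litVal, Prod.mk.injEq, true_and]
        rcases τ l2.1 <;> rcases l2.2 <;> rfl
      · refine ⟨v, Or.inr (Or.inr rfl), ?_⟩
        simp only [Prod.mk.injEq, true_and]
        have hτ' : ¬ (τ v = g (litVal τ l1) (litVal τ l2)) := hτ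
        revert hτ'
        generalize τ v = a
        generalize g (litVal τ l1) (litVal τ l2) = a'
        revert a a'
        decide

/-! ### Chains -/

/-- The equation that the new parity is the old one plus the literal; all variables occur. -/
def StepEq (F : CNF ℕ) (L : List (Clause ℕ)) (p : ℕ) (l : Lit ℕ) (p' : ℕ) : Prop :=
  Ent F L {p, l.1, p'} (fun τ => τ p' = (τ p ^^ litVal τ l)) ∧ Occurs F L l.1 ∧ Occurs F L p'

/-- A chain of partial parities along a list of literals. -/
inductive Chain (F : CNF ℕ) (L : List (Clause ℕ)) : ℕ → List (Lit ℕ) → ℕ → Prop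
  | nil (p : ℕ) : Chain F L p [] p
  | cons {p p' e : ℕ} {l : Lit ℕ} {ls : List (Lit ℕ)} :
      StepEq F L p l p' → Chain F L p' ls e → Chain F L p (l :: ls) e

theorem StepEq.mono {F : CNF ℕ} {L L' : List (Clause ℕ)} {p p' : ℕ} {l : Lit ℕ}
    (h : StepEq F L p l p') (hL : L ⊆ L') : StepEq F L' p l p' :=
  ⟨h.1.mono hL, h.2.1.mono hL, h.2.2.mono hL⟩

theorem Chain.mono {F : CNF ℕ} {L L' : List (Clause ℕ)} {p e : ℕ} {ls : List (Lit ℕ)}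
    (h : Chain F L p ls e) (hL : L ⊆ L') : Chain F L' p ls e := by
  induction h with
  | nil => exact Chain.nil _
  | cons hs _ ih => exact Chain.cons (hs.mono hL) ih

theorem Chain.append {F : CNF ℕ} {L : List (Clause ℕ)} {p q e : ℕ} {ls ms : List (Lit ℕ)}
    (h : Chain F L p ls q) (h' : Chain F L q ms e) : Chain F L p (ls ++ ms) e := by
  induction h with
  | nil => exact h'
  | cons hs _ ih => exact Chain.cons hs (ih h')

theorem Chain.split {F : CNF ℕ} (f : Lit ℕ → Bool) (ls : List (Lit ℕ)) :
    ∀ {L : List (Clause ℕ)} {p e q r : ℕ}, IsERDeriv F L → Chain F L p ls e →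
    Occurs F L q → Occurs F L r → Ent F L {p, q, r} (fun τ => τ p = (τ q ^^ τ r)) →
    ∃ L' e1 e2, ExtBy F L (200 * ls.length) L' ∧ Chain F L' q (ls.filter f) e1 ∧
      Chain F L' r (ls.filter (fun l => !f l)) e2 ∧
      Ent F L' {e, e1, e2} (fun τ => τ e = (τ e1 ^^ τ e2)) := by
  induction ls with
  | nil =>
    intro L p e q r hL hc hq hr h
    cases hc
    exact ⟨L, q, r, ExtBy.same hL, Chain.nil _, Chain.nil _, h⟩
  | cons l ls ih =>
    intro L p e q r hL hc hq hr h
    cases hc with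
    | @cons _ p' _ _ _ hs hc =>
    have aux : ∀ {L : List (Clause ℕ)} {q r : ℕ}, IsERDeriv F L → StepEq F L p l p' →
        Occurs F L q → Ent F L {p, q, r} (fun τ => τ p = (τ q ^^ τ r)) →
        ∃ L' q', ExtBy F L 196 L' ∧ StepEq F L' q l q' ∧
          Ent F L' {p', q', r} (fun τ => τ p' = (τ q' ^^ τ r)) := by
      intro L q r hL hs hq h
      obtain ⟨L1, q', hL1, hq', h1⟩ := extend_var (fun a b => a ^^ b) (q, true) l hL hq hs.2.1
      obtain ⟨L2, hL2, h2⟩ := derive (W := {p', q', r})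
        (Q := fun τ => τ p' = (τ q' ^^ τ r)) hL1.1
        (((h.mono hL1.2.1).and (hs.1.mono hL1.2.1)).and h1) (by
          rintro τ ⟨⟨a, b⟩, c⟩
          simp only [litVal] at *
          rw [b, a, c]
          rcases τ q <;> rcases τ r <;> rcases τ l.1 <;> rcases l.2 <;> rfl)
        (by
          refine (Finset.card_le_card (t := {p, q, r, l.1, p', q'}) ?_).trans Finset.card_le_six
          intro v; simp only [Finset.mem_union, Finset.mem_insert, Finset.mem_singleton]; tauto)
        (by
          intro τ τ' hh
          rw [hh p' (by simp), hh q' (by simp), hh r (by simp)]; exact id)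
      refine ⟨L2, q', hL1.trans hL2, ⟨?_, hs.2.1.mono (hL1.trans hL2).2.1, hq'.mono hL2.2.1⟩, h2⟩
      refine (h1.mono hL2.2.1).weak (fun v hv => hv) ?_
      intro τ hτ
      rw [hτ]
      simp [litVal]
    by_cases hf : f l = true
    · obtain ⟨L1, q', hL1, hs1, h1⟩ := aux hL hs hq h
      obtain ⟨L2, e1, e2, hL2, hc1, hc2, h2⟩ := ih hL1.1 (hc.mono hL1.2.1) hs1.2.2
        (hr.mono hL1.2.1) h1
      refine ⟨L2, e1, e2, (hL1.trans hL2).mono (by simp; omega), ?_, ?_, h2⟩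
      · rw [List.filter_cons_of_pos (by simpa using hf)]
        exact Chain.cons (hs1.mono hL2.2.1) hc1
      · rw [List.filter_cons_of_neg (by simpa using hf)]
        exact hc2
    · obtain ⟨L1, r', hL1, hs1, h1⟩ := aux (q := r) (r := q) hL hs hr
        (h.weak (by intro v; simp only [Finset.mem_insert, Finset.mem_singleton]; tauto)
          (by intro τ hτ; rw [hτ, Bool.xor_comm]))
      obtain ⟨L2, e1, e2, hL2, hc1, hc2, h2⟩ := ih (q := q) (r := r') hL1.1 (hc.mono hL1.2.1)
        (hq.mono hL1.2.1) hs1.2.2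
        (h1.weak (by intro v; simp only [Finset.mem_insert, Finset.mem_singleton]; tauto)
          (by intro τ hτ; rw [hτ, Bool.xor_comm]))
      refine ⟨L2, e1, e2, (hL1.trans hL2).mono (by simp; omega), ?_, ?_, h2⟩
      · rw [List.filter_cons_of_neg (by simpa using hf)]
        exact hc1
      · rw [List.filter_cons_of_pos (by simpa using hf)]
        exact Chain.cons (hs1.mono hL2.2.1) hc2

theorem parVal_congr {τ τ' : ℕ → Bool} (ls : List (Lit ℕ)) (h : ∀ l ∈ ls, τ l.1 = τ' l.1) :
    parVal τ ls = parVal τ' ls := by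
  induction ls with
  | nil => rfl
  | cons l ls ih =>
    simp only [parVal, litVal]
    rw [h l (by simp), ih (fun m hm => h m (by simp [hm]))]

theorem parVal_filter (τ : ℕ → Bool) (f : Lit ℕ → Bool) (ls : List (Lit ℕ)) :
    parVal τ ls = (parVal τ (ls.filter f) ^^ parVal τ (ls.filter (fun l => !f l))) := by
  induction ls with
  | nil => rfl
  | cons l ls ih =>
    by_cases hf : f l = true
    · rw [List.filter_cons_of_pos (by simpa using hf), List.filter_cons_of_neg (by simpa using hf)]
      simp only [parVal]
      rw [ih, Bool.xor_assoc]
    · rw [List.filter_cons_of_neg (by simpa using hf), List.filter_cons_of_pos (by simpa using hf)]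
      simp only [parVal]
      rw [ih, Bool.xor_left_comm]

/-- Base case: chain over a single variable. -/
theorem Chain.single {F : CNF ℕ} {v : ℕ} (ls : List (Lit ℕ)) :
    ∀ {L : List (Clause ℕ)} {p e : ℕ} {b c : Bool}, IsERDeriv F L → Chain F L p ls e →
    (∀ l ∈ ls, l.1 = v) → Ent F L {p, v} (fun τ => τ p = (b ^^ (c && τ v))) →
    ∃ L', ExtBy F L (200 * ls.length) L' ∧
      Ent F L' {e, v} (fun τ => τ e = (b ^^ (c && τ v) ^^ parVal τ ls)) := by
  induction ls with
  | nil =>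
    intro L p e b c hL hc hv h
    cases hc
    exact ⟨L, ExtBy.same hL, by simpa [parVal] using h⟩
  | cons l ls ih =>
    intro L p e b c hL hc hv h
    cases hc with
    | @cons _ p' _ _ _ hs hc =>
    have hl : l.1 = v := hv l (by simp)
    obtain ⟨L1, hL1, h1⟩ := derive (W := {p', v})
      (Q := fun τ => τ p' = ((b ^^ !l.2) ^^ ((!c) && τ v))) hL (h.and hs.1) (by
        rintro τ ⟨a, a'⟩
        simp only [litVal] at *
        rw [a', a, hl]
        rcases τ v <;> rcases l.2 <;> cases b <;> cases c <;> rfl)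
      (by
        refine (Finset.card_le_card (t := {p, v, p'}) ?_).trans
          (Finset.card_le_three.trans (by norm_num))
        rw [hl]
        intro v; simp only [Finset.mem_union, Finset.mem_insert, Finset.mem_singleton]; tauto)
      (by
        intro τ τ' hh
        rw [hh p' (by simp), hh v (by simp)]; exact id)
    obtain ⟨L2, hL2, h2⟩ := ih hL1.1 (hc.mono hL1.2.1) (fun m hm => hv m (by simp [hm])) h1
    refine ⟨L2, (hL1.trans hL2).mono (by simp; omega), h2.weak (fun _ h => h) ?_⟩
    intro τ hτ
    rw [hτ]
    simp only [parVal, litVal, hl]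
    rcases τ v <;> rcases l.2 <;> cases b <;> cases c <;> simp

/-- Main lemma: a chain over a list whose parity is constant can be evaluated. -/
theorem Chain.value {F : CNF ℕ} {z : ℕ} (k : ℕ) :
    ∀ {L : List (Clause ℕ)} {ls : List (Lit ℕ)} {lo e : ℕ} {b : Bool}, IsERDeriv F L →
    Occurs F L z → Ent F L {z} (fun τ => τ z = false) →
    Chain F L z ls e → (∀ l ∈ ls, lo ≤ l.1 ∧ l.1 < lo + 2 ^ k) → (∀ τ, parVal τ ls = b) →
    ∃ L', IsERDeriv F L' ∧ L ⊆ L' ∧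
      L'.length + 192 ≤ L.length + 200 * ls.length * (k + 1) + 192 * 2 ^ (k + 1) ∧
      Ent F L' {e} (fun τ => τ e = b) := by
  induction k with
  | zero =>
    intro L ls lo e b hL hzo hz hc hr hb
    obtain ⟨L1, hL1, h1⟩ := Chain.single (v := lo) (b := false) (c := false) ls hL hc
      (fun l hl => by have := hr l hl; simp at this; omega)
      (hz.weak (by simp) (by simp))
    obtain ⟨L2, hL2, h2⟩ := derive (W := {e}) (Q := fun τ => τ e = b) hL1.1 h1
      (by intro τ hτ; rw [hτ, hb]; simp)
      (by
        refine (Finset.card_le_card (t := {e, lo}) ?_).trans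
          (Finset.card_le_two.trans (by norm_num))
        intro v; simp only [Finset.mem_union, Finset.mem_insert, Finset.mem_singleton]; tauto)
      (by intro τ τ' hh; rw [hh e (by simp)]; exact id)
    have h12 := hL1.trans hL2
    refine ⟨L2, h12.1, h12.2.1, ?_, h2⟩
    have := h12.2.2
    simp; omega
  | succ k ih =>
    intro L ls lo e b hL hzo hz hc hr hb
    let f : Lit ℕ → Bool := fun l => decide (l.1 < lo + 2 ^ k)
    obtain ⟨L1, e1, e2, hL1, hc1, hc2, h1⟩ := Chain.split f ls (q := z) (r := z) hL hc hzo hzo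
      (hz.weak (by simp) (by intro τ hτ; simp [hτ]))
    have hcon : ∀ τ, parVal τ (ls.filter f) =
          (b ^^ parVal (fun _ => false) (ls.filter (fun l => !f l))) ∧
        parVal τ (ls.filter (fun l => !f l)) = (b ^^ parVal (fun _ => false) (ls.filter f)) := by
      intro τ
      constructor
      · have h := hb (fun x => if x < lo + 2 ^ k then τ x else false)
        rw [parVal_filter _ f] at h
        rw [parVal_congr (τ' := τ) (ls.filter f), parVal_congr (τ' := fun _ => false)
          (ls.filter (fun l => !f l))] at h
        · rw [← h]; simp
        · intro l hl
          have := (List.mem_filter.1 hl).2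
          simp only [f, Bool.not_eq_true', decide_eq_false_iff_not] at this
          simp [this]
        · intro l hl
          have := (List.mem_filter.1 hl).2
          simp only [f, decide_eq_true_eq] at this
          simp [this]
      · have h := hb (fun x => if x < lo + 2 ^ k then false else τ x)
        rw [parVal_filter _ f] at h
        rw [parVal_congr (τ' := fun _ => false) (ls.filter f), parVal_congr (τ' := τ)
          (ls.filter (fun l => !f l))] at h
        · rw [← h]; simp [Bool.xor_comm]
        · intro l hl
          have := (List.mem_filter.1 hl).2
          simp only [f, Bool.not_eq_true', decide_eq_false_iff_not] at this
          simp [this]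
        · intro l hl
          have := (List.mem_filter.1 hl).2
          simp only [f, decide_eq_true_eq] at this
          simp [this]
    obtain ⟨L2, hL2, hs2, hlen2, h2⟩ := ih (lo := lo) hL1.1 (hzo.mono hL1.2.1) (hz.mono hL1.2.1) hc1
      (by
        intro l hl
        have h := List.mem_filter.1 hl
        have h' := h.2
        simp only [f, decide_eq_true_eq] at h'
        exact ⟨(hr l h.1).1, h'⟩) (fun τ => (hcon τ).1)
    have hs12 : L ⊆ L2 := fun _ hx => hs2 (hL1.2.1 hx)
    obtain ⟨L3, hL3, hs3, hlen3, h3⟩ := ih (lo := lo + 2 ^ k) hL2 (hzo.mono hs12) (hz.mono hs12)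
      (hc2.mono hs2)
      (by
        intro l hl
        have h := List.mem_filter.1 hl
        have h' := h.2
        simp only [f, Bool.not_eq_true', decide_eq_false_iff_not] at h'
        have := (hr l h.1).2
        rw [pow_succ] at this
        omega) (fun τ => (hcon τ).2)
    have hs23 : L1 ⊆ L3 := fun _ hx => hs3 (hs2 hx)
    obtain ⟨L4, hL4, h4⟩ := derive (W := {e}) (Q := fun τ => τ e = b) hL3
      (((h1.mono hs23).and (h2.mono hs3)).and h3)
      (by
        rintro τ ⟨⟨a, b⟩, c⟩
        rw [a, b, c]
        have h := hb (fun _ => false)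
        rw [parVal_filter _ f] at h
        revert h
        rcases parVal (fun _ => false) (ls.filter f) <;>
          rcases parVal (fun _ => false) (ls.filter (fun l => !f l)) <;> intro h <;> subst h <;> rfl)
      (by
        refine (Finset.card_le_card (t := {e, e1, e2}) ?_).trans
          (Finset.card_le_three.trans (by norm_num))
        intro v; simp only [Finset.mem_union, Finset.mem_insert, Finset.mem_singleton]; tauto)
      (by intro τ τ' hh; rw [hh e (by simp)]; exact id)
    refine ⟨L4, hL4.1, fun _ hx => hL4.2.1 (hs23 (hL1.2.1 hx)), ?_, h4⟩
    have hlen4 := hL4.2.2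
    have hlen1 := hL1.2.2
    have hsum : (ls.filter f).length + (ls.filter (fun l => !f l)).length = ls.length :=
      (List.length_eq_length_filter_add f).symm
    have e1 : 200 * ls.length * (k + 1) = 200 * (ls.filter f).length * (k + 1) +
        200 * (ls.filter (fun l => !f l)).length * (k + 1) := by rw [← hsum]; ring
    have e2 : 200 * ls.length * (k + 1 + 1) = 200 * ls.length * (k + 1) + 200 * ls.length := by ring
    have e3 : 192 * 2 ^ (k + 1 + 1) = 192 * 2 ^ (k + 1) + 192 * 2 ^ (k + 1) := by ring
    omega

/-! ### Chains from the parity encodings -/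

theorem mem_xorCNF (l1 l2 l3 : Lit ℕ) (b1 b2 b3 : Bool) (h : (b1 ^^ b2 ^^ b3) = true) :
    ({if b1 then negLit l1 else l1, if b2 then negLit l2 else l2,
      if b3 then negLit l3 else l3} : Clause ℕ) ∈ xorCNF [l1, l2, l3] := by
  unfold xorCNF parityCNF
  rw [Finset.mem_image]
  refine ⟨(![b1, b2, b3] : Fin 3 → Bool), ?_, ?_⟩
  · rw [Finset.mem_filter]
    refine ⟨Finset.mem_univ _, ?_⟩
    change (Finset.univ.filter (fun i : Fin 3 => ![b1, b2, b3] i = true)).card % 2 = 1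
    revert h
    revert b1 b2 b3
    decide
  · ext l
    simp only [Finset.mem_image, Finset.mem_univ, true_and, Finset.mem_insert,
      Finset.mem_singleton]
    constructor
    · rintro ⟨i, rfl⟩
      change Fin 3 at i
      fin_cases i
      · exact Or.inl rfl
      · exact Or.inr (Or.inl rfl)
      · exact Or.inr (Or.inr rfl)
    · rintro (rfl | rfl | rfl)
      · exact ⟨(0 : Fin 3), rfl⟩
      · exact ⟨(1 : Fin 3), rfl⟩
      · exact ⟨(2 : Fin 3), rfl⟩

theorem signed_fst (b : Bool) (l : Lit ℕ) : (if b then negLit l else l).1 = l.1 := by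
  cases b <;> rfl

theorem signed_eq (τ : ℕ → Bool) (l : Lit ℕ) :
    (if litVal τ l then negLit l else l) = (l.1, !τ l.1) := by
  obtain ⟨x, b⟩ := l
  simp only [litVal, negLit]
  by_cases h : τ x = b
  · simp [h]
  · have h' : b = !τ x := by
      revert h
      generalize τ x = c
      revert b c
      decide
    rw [h']
    simp

theorem xor_spec {F : CNF ℕ} {L : List (Clause ℕ)} {l1 l2 l3 : Lit ℕ}
    (h : xorCNF [l1, l2, l3] ⊆ F) :
    Ent F L {l1.1, l2.1, l3.1} (fun τ => (litVal τ l1 ^^ litVal τ l2 ^^ litVal τ l3) = false) ∧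
      Occurs F L l1.1 ∧ Occurs F L l2.1 ∧ Occurs F L l3.1 := by
  have hm := h (mem_xorCNF l1 l2 l3 true false false rfl)
  refine ⟨?_, Or.inl ⟨_, hm, (negLit l1).2, ?_⟩, Or.inl ⟨_, hm, l2.2, ?_⟩,
    Or.inl ⟨_, hm, l3.2, ?_⟩⟩
  · intro τ hτ
    refine ⟨_, Or.inl (h (mem_xorCNF l1 l2 l3 _ _ _ (by simpa using hτ))), ?_⟩
    rw [signed_eq, signed_eq, signed_eq]
    intro l
    simp only [falsClause, Finset.mem_image, Finset.mem_insert, Finset.mem_singleton]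
    rintro (rfl | rfl | rfl)
    · exact ⟨_, Or.inl rfl, rfl⟩
    · exact ⟨_, Or.inr (Or.inl rfl), rfl⟩
    · exact ⟨_, Or.inr (Or.inr rfl), rfl⟩
  · simp [negLit]
  · simp
  · simp

theorem parity_chain {F : CNF ℕ} {L : List (Clause ℕ)} {z : ℕ} (xs : List (Lit ℕ)) (t : ℕ → ℕ)
    (hlen : 4 ≤ xs.length) (hF : ParityCNF xs t ⊆ F) (hL : IsERDeriv F L)
    (hzo : Occurs F L z) (hz : Ent F L {z} (fun τ => τ z = false)) :
    ∃ L', ExtBy F L 392 L' ∧ Chain F L' z xs z := by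
  have hctr : ∀ j, j < xs.length - 2 → xorCNF (parityCtr xs t j) ⊆ F := by
    intro j hj C hC
    apply hF
    simp only [ParityCNF, Finset.mem_biUnion, Finset.mem_range]
    exact ⟨j, hj, hC⟩
  obtain ⟨x, hx⟩ : ∃ x : ℕ → Lit ℕ, ∀ i, x i = xs.getD i (t 0, true) := ⟨_, fun _ => rfl⟩
  have htake : ∀ i, i < xs.length → xs.take (i + 1) = xs.take i ++ [x i] := by
    intro i hi
    rw [hx, List.getD_eq_getElem _ _ hi, List.take_append_getElem hi]
  have hc0 : xorCNF [x 0, x 1, (t 0, true)] ⊆ F := by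
    have := hctr 0 (by omega)
    simpa [parityCtr, hx] using this
  have hcm : ∀ i, i + 1 < xs.length - 3 →
      xorCNF [(t i, true), x (i + 2), (t (i + 1), true)] ⊆ F := by
    intro i hi
    have := hctr (i + 1) (by omega)
    rw [parityCtr, if_neg (by omega), if_pos hi] at this
    simpa [hx] using this
  have hce : xorCNF [(t (xs.length - 4), true), x (xs.length - 2), x (xs.length - 1)] ⊆ F := by
    have := hctr (xs.length - 3) (by omega)
    rw [parityCtr, if_neg (by omega), if_neg (by omega)] at this
    simpa [hx] using this
  -- the two end constraints
  have hend : ∀ {L : List (Clause ℕ)} {l l' : Lit ℕ} {s : ℕ}, IsERDeriv F L →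
      Ent F L {l.1, l'.1, s} (fun τ => (litVal τ l ^^ litVal τ l' ^^ τ s) = false) →
      Occurs F L l.1 → ∃ L' w, ExtBy F L 196 L' ∧ Occurs F L' w ∧
        Ent F L' {l.1, w} (fun τ => τ w = litVal τ l) ∧
        Ent F L' {w, l'.1, s} (fun τ => (τ w ^^ litVal τ l' ^^ τ s) = false) := by
    intro L l l' s hL h ho
    obtain ⟨L1, w, hL1, hw, h1⟩ := extend_var (fun a _ => a) l l hL ho ho
    obtain ⟨L2, hL2, h2⟩ := derive (W := {w, l'.1, s})
      (Q := fun τ => (τ w ^^ litVal τ l' ^^ τ s) = false) hL1.1 ((h.mono hL1.2.1).and h1)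
      (by rintro τ ⟨a, b⟩; rw [b]; exact a)
      (by
        refine (Finset.card_le_card (t := {w, l.1, l'.1, s}) ?_).trans
          (Finset.card_le_four.trans (by norm_num))
        intro v; simp only [Finset.mem_union, Finset.mem_insert, Finset.mem_singleton]; tauto)
      (by
        intro τ τ' hh
        simp only [litVal]
        rw [hh w (by simp), hh l'.1 (by simp), hh s (by simp)]; exact id)
    exact ⟨L2, w, hL1.trans hL2, hw.mono hL2.2.1,
      (h1.mono hL2.2.1).weak (by simp) (fun _ h => h), h2⟩
  obtain ⟨H0, ho0, ho1, hot⟩ := xor_spec (L := L) hc0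
  obtain ⟨L1, w, hL1, hw, hwd, hws⟩ := hend (l := x 0) (l' := x 1) (s := t 0) hL
    (H0.weak (fun _ h => h) (by intro τ; simp [litVal])) ho0
  obtain ⟨He, hoe0, hoe1, hoe2⟩ := xor_spec (L := L1) hce
  obtain ⟨L2, w', hL2, hw', hwd', hws'⟩ := hend (l := x (xs.length - 1))
    (l' := x (xs.length - 2)) (s := t (xs.length - 4)) hL1.1
    (He.weak (by intro v; simp only [Finset.mem_insert, Finset.mem_singleton]; tauto)
      (by
        intro τ hτ
        rw [← hτ]
        simp only [litVal, beq_true]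
        rw [Bool.xor_comm, Bool.xor_comm (τ (x (xs.length - 1)).1 == (x (xs.length - 1)).2),
          Bool.xor_assoc])) hoe2
  have hL12 := hL1.trans hL2
  refine ⟨L2, hL12, ?_⟩
  have hmid : ∀ i, i + 4 ≤ xs.length → Chain F L2 z (xs.take (i + 2)) (t i) := by
    intro i
    induction i with
    | zero =>
      intro _
      rw [htake 1 (by omega), htake 0 (by omega)]
      refine Chain.cons (p' := w) ⟨?_, ho0.mono hL12.2.1, hw.mono hL2.2.1⟩
        (Chain.cons (p' := t 0) ⟨?_, ho1.mono hL12.2.1, hot.mono hL12.2.1⟩ (Chain.nil _))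
      · refine ((hz.mono hL12.2.1).and (hwd.mono hL2.2.1)).weak ?_ ?_
        · intro v; simp only [Finset.mem_union, Finset.mem_insert, Finset.mem_singleton]; tauto
        · rintro τ ⟨a, b⟩
          rw [a, b]; simp
      · refine (hws.mono hL2.2.1).weak (fun _ h => h) ?_
        intro τ
        rcases τ w <;> rcases litVal τ (x 1) <;> rcases τ (t 0) <;> simp
    | succ i ih =>
      intro hi
      rw [show i + 1 + 2 = (i + 2) + 1 by omega, htake (i + 2) (by omega)]
      obtain ⟨H, _, o2, o3⟩ := xor_spec (L := L2) (hcm i (by omega))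
      refine (ih (by omega)).append (Chain.cons (p' := t (i + 1)) ⟨?_, o2, o3⟩ (Chain.nil _))
      refine H.weak (fun _ h => h) ?_
      intro τ
      simp only [litVal]
      generalize (τ (x (i + 2)).1 == (x (i + 2)).2) = c
      rcases τ (t i) <;> rcases τ (t (i + 1)) <;> cases c <;> simp
  have hfin := hmid (xs.length - 4) (by omega)
  have hxs : xs = xs.take (xs.length - 4 + 2) ++ [x (xs.length - 2), x (xs.length - 1)] := by
    have h1 := htake (xs.length - 2) (by omega)
    have h2 := htake (xs.length - 1) (by omega)
    rw [show xs.length - 2 + 1 = xs.length - 1 by omega] at h1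
    rw [show xs.length - 1 + 1 = xs.length by omega, List.take_length, h1] at h2
    rw [show xs.length - 4 + 2 = xs.length - 2 by omega]
    simpa using h2
  have hlast : Chain F L2 (t (xs.length - 4)) [x (xs.length - 2), x (xs.length - 1)] z := by
    refine Chain.cons (p' := w') ⟨?_, hoe1.mono hL2.2.1, hw'⟩
      (Chain.cons (p' := z) ⟨?_, hoe2.mono hL2.2.1, hzo.mono hL12.2.1⟩ (Chain.nil _))
    · refine hws'.weak ?_ ?_
      · intro v; simp only [Finset.mem_insert, Finset.mem_singleton]; tauto
      · intro τ
        rcases τ w' <;> rcases litVal τ (x (xs.length - 2)) <;>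
          rcases τ (t (xs.length - 4)) <;> simp
    · refine ((hz.mono hL12.2.1).and hwd').weak ?_ ?_
      · intro v; simp only [Finset.mem_union, Finset.mem_insert, Finset.mem_singleton]; tauto
      · rintro τ ⟨a, b⟩
        rw [a, b]; simp
  have := hfin.append hlast
  rwa [← hxs] at this

/-! ### Parity of the three lists -/

/-- Boolean as an element of `ZMod 2`. -/
def boolZ (b : Bool) : ZMod 2 := if b then 1 else 0

theorem boolZ_xor (a b : Bool) : boolZ (a ^^ b) = boolZ a + boolZ b := by
  revert a b; decide

theorem boolZ_inj {a b : Bool} (h : boolZ a = boolZ b) : a = b := by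
  revert a b; decide

theorem boolZ_parVal (τ : ℕ → Bool) (ls : List (Lit ℕ)) :
    boolZ (parVal τ ls) = (ls.map (fun l => boolZ (litVal τ l))).sum := by
  induction ls with
  | nil => rfl
  | cons l ls ih => simp [parVal, boolZ_xor, ih]

theorem posLits_eq {n : ℕ} (l : List (Fin n)) :
    posLits l = l.map (fun i : Fin n => ((i : ℕ), true)) := by
  unfold posLits
  induction l with
  | nil => rfl
  | cons a l ih => simp_all

theorem orderedElems_nodup {n : ℕ} (A : Finset (Fin n)) (σ : Equiv.Perm (Fin n)) :
    (orderedElems A σ).Nodup :=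
  (List.nodup_ofFn.2 σ.injective).filter _

theorem orderedElems_toFinset {n : ℕ} (A : Finset (Fin n)) (σ : Equiv.Perm (Fin n)) :
    (orderedElems A σ).toFinset = A := by
  ext i
  simp only [orderedElems, List.mem_toFinset, List.mem_filter, List.mem_ofFn, decide_eq_true_eq]
  exact ⟨fun h => h.2, fun h => ⟨⟨σ.symm i, by simp⟩, h⟩⟩

theorem orderedElems_length {n : ℕ} (A : Finset (Fin n)) (σ : Equiv.Perm (Fin n)) :
    (orderedElems A σ).length = A.card := by
  rw [← List.toFinset_card_of_nodup (orderedElems_nodup A σ), orderedElems_toFinset]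

theorem orderedElems_sum {n : ℕ} (A : Finset (Fin n)) (σ : Equiv.Perm (Fin n))
    (g : Fin n → ZMod 2) : ((orderedElems A σ).map g).sum = ∑ i ∈ A, g i := by
  rw [← List.sum_toFinset g (orderedElems_nodup A σ), orderedElems_toFinset]

theorem parVal_append (τ : ℕ → Bool) (ls ms : List (Lit ℕ)) :
    parVal τ (ls ++ ms) = (parVal τ ls ^^ parVal τ ms) := by
  induction ls with
  | nil => simp [parVal]
  | cons l ls ih => simp [parVal, ih]

theorem parVal_total {n : ℕ} (A B : Finset (Fin n)) (σa σb σc : Equiv.Perm (Fin n))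
    (hne : (symmDiff A B).Nonempty) (τ : ℕ → Bool) :
    parVal τ (posLits (orderedElems A σa) ++ posLits (orderedElems B σb) ++ symmLits A B σc)
      = true := by
  apply boolZ_inj
  rw [parVal_append, parVal_append, boolZ_xor, boolZ_xor, boolZ_parVal, boolZ_parVal, boolZ_parVal]
  simp only [posLits_eq, symmLits, List.map_map]
  rw [orderedElems_sum, orderedElems_sum, orderedElems_sum]
  obtain ⟨m, hm⟩ := Finset.max_of_nonempty hne
  have hmem : m ∈ symmDiff A B := Finset.mem_of_max hm
  have e1 : ∀ i : Fin n, ((fun l => boolZ (litVal τ l)) ∘ fun i : Fin n => ((i : ℕ), true)) i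
      = boolZ (τ i) := by intro i; simp [litVal]
  have e2 : ∀ i : Fin n, ((fun l => boolZ (litVal τ l)) ∘ fun i : Fin n =>
      ((i : ℕ), decide ((i : WithBot (Fin n)) ≠ (symmDiff A B).max))) i
      = boolZ (τ i) + if m = i then 1 else 0 := by
    intro i
    rw [hm]
    by_cases h : m = i
    · subst h
      simp only [litVal, Function.comp]
      rcases τ m <;> simp [boolZ]
      decide
    · have h' : i ≠ m := fun h' => h h'.symm
      simp [litVal, h, h']
  rw [Finset.sum_congr rfl (fun i _ => e1 i), Finset.sum_congr rfl (fun i _ => e1 i),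
    Finset.sum_congr rfl (fun i _ => e2 i), Finset.sum_add_distrib, Finset.sum_ite_eq,
    if_pos hmem, ← add_assoc]
  have hz : ∑ i ∈ A, boolZ (τ i) + ∑ i ∈ B, boolZ (τ i) + ∑ i ∈ symmDiff A B, boolZ (τ i) = 0 := by
    have conv : ∀ S : Finset (Fin n), ∑ i ∈ S, boolZ (τ i) =
        ∑ i, if i ∈ S then boolZ (τ i) else 0 := by
      intro S; simp
    rw [conv A, conv B, conv (symmDiff A B), ← Finset.sum_add_distrib, ← Finset.sum_add_distrib]
    apply Finset.sum_eq_zero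
    intro i _
    have two : ∀ b, boolZ b + boolZ b = 0 := by decide
    by_cases hA : i ∈ A <;> by_cases hB : i ∈ B <;> simp [Finset.mem_symmDiff, hA, hB, two]
  rw [hz]
  simp [boolZ]

/-! ### The refutation -/

theorem refute_of_subs {F : CNF ℕ} {L : List (Clause ℕ)} (hL : IsERDeriv F L)
    (h : Subs F L ∅) : ∃ L', IsERRefutation F L' ∧ L'.length ≤ L.length + 1 := by
  obtain ⟨D, hD, hs⟩ := h
  obtain rfl := Finset.subset_empty.1 hs
  rcases hD with hD | hD
  · exact ⟨L ++ [∅], ⟨er_snoc hL (Or.inl hD), by simp⟩, by simp⟩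
  · obtain ⟨i, hi, he⟩ := List.mem_iff_getElem.1 hD
    refine ⟨L.take (i + 1), ⟨?_, ?_⟩, by rw [List.length_take]; omega⟩
    · intro j hj
      have hj' : j < L.length := by simp at hj; omega
      have := hL j hj'
      simpa only [List.getElem_take] using this
    · rw [List.take_succ_eq_append_getElem hi, he]; simp

theorem refute_nat (n : ℕ) (A B : Finset (Fin n)) (hA : 4 ≤ A.card) (hB : 4 ≤ B.card)
    (hC : 4 ≤ (symmDiff A B).card) (σa σb σc : Equiv.Perm (Fin n)) (k : ℕ) (hk : n ≤ 2 ^ k) :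
    ∃ L : List (Clause ℕ), IsERRefutation (rAddPar n A B σa σb σc) L ∧
      L.length ≤ 1400 + 600 * n * (k + 1) + 384 * 2 ^ k := by
  obtain ⟨F, hF⟩ : ∃ F, F = rAddPar n A B σa σb σc := ⟨_, rfl⟩
  rw [← hF]
  have hlA : (posLits (orderedElems A σa)).length = A.card := by
    simp [posLits_eq, orderedElems_length]
  have hlB : (posLits (orderedElems B σb)).length = B.card := by
    simp [posLits_eq, orderedElems_length]
  have hlC : (symmLits A B σc).length = (symmDiff A B).card := by
    simp [symmLits, orderedElems_length]
  have hFA : ParityCNF (posLits (orderedElems A σa)) (fun k => n + k) ⊆ F := by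
    rw [hF]; intro D hD; simp only [rAddPar, Finset.mem_union]; tauto
  have hFB : ParityCNF (posLits (orderedElems B σb)) (fun k => 2 * n + k) ⊆ F := by
    rw [hF]; intro D hD; simp only [rAddPar, Finset.mem_union]; tauto
  have hFC : ParityCNF (symmLits A B σc) (fun k => 3 * n + k) ⊆ F := by
    rw [hF]; intro D hD; simp only [rAddPar, Finset.mem_union]; tauto
  have h0 : IsERDeriv F [] := by intro i hi; simp at hi
  -- some occurring variable
  have hocc : Occurs F [] (n + 0) := by
    have : xorCNF (parityCtr (posLits (orderedElems A σa)) (fun k => n + k) 0) ⊆ F := by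
      intro D hD
      apply hFA
      simp only [ParityCNF, Finset.mem_biUnion, Finset.mem_range]
      exact ⟨0, by omega, hD⟩
    rw [parityCtr, if_pos rfl] at this
    exact (xor_spec (L := []) this).2.2.2
  obtain ⟨L1, z, hL1, hzo, hzd⟩ := extend_var (fun _ _ => false) (n + 0, true) (n + 0, true)
    h0 hocc hocc
  obtain ⟨L2, hL2, hz⟩ := derive (W := {z}) (Q := fun τ => τ z = false) hL1.1 hzd
    (fun _ h => h)
    (by
      refine (Finset.card_le_card (t := {n + 0, z}) ?_).trans
        (Finset.card_le_two.trans (by norm_num))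
      intro v; simp only [Finset.mem_union, Finset.mem_insert, Finset.mem_singleton]; tauto)
    (by intro τ τ' hh; rw [hh z (by simp)]; exact id)
  have hzo2 := hzo.mono hL2.2.1
  obtain ⟨L3, hL3, hcA⟩ := parity_chain _ _ (by omega) hFA hL2.1 hzo2 hz
  obtain ⟨L4, hL4, hcB⟩ := parity_chain _ _ (by omega) hFB hL3.1 (hzo2.mono hL3.2.1)
    (hz.mono hL3.2.1)
  have h34 := hL3.trans hL4
  obtain ⟨L5, hL5, hcC⟩ := parity_chain _ _ (by omega) hFC hL4.1 (hzo2.mono h34.2.1)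
    (hz.mono h34.2.1)
  have h35 := h34.trans hL5
  have h45 := hL4.trans hL5
  have hchain := ((hcA.mono h45.2.1).append (hcB.mono hL5.2.1)).append hcC
  obtain ⟨L6, hL6, hs6, hlen6, hz6⟩ := Chain.value (F := F) (z := z) k (lo := 0) (b := true) hL5.1
    (hzo2.mono h35.2.1) (hz.mono h35.2.1) hchain
    (by
      intro l hl
      refine ⟨Nat.zero_le _, ?_⟩
      rw [zero_add]
      refine lt_of_lt_of_le ?_ hk
      simp only [posLits_eq, symmLits, List.mem_append, List.mem_map] at hl
      rcases hl with (⟨i, _, rfl⟩ | ⟨i, _, rfl⟩) | ⟨i, _, rfl⟩ <;> exact i.2)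
    (parVal_total A B σa σb σc (Finset.card_pos.1 (by omega)))
  obtain ⟨L7, hL7, h7⟩ := derive (W := ∅) (Q := fun _ => False) hL6
    (hz6.and (hz.mono (fun _ hx => hs6 (h35.2.1 hx))))
    (by rintro τ ⟨a, b⟩; rw [a] at b; exact absurd b (by decide))
    (by simp)
    (by intro _ _ _ h; exact h)
  have hsub : Subs F L7 ∅ := by
    have := h7 (fun _ => false) id
    simpa [falsClause] using this
  obtain ⟨L8, hL8, hlen8⟩ := refute_of_subs hL7.1 hsub
  refine ⟨L8, hL8, ?_⟩
  have a1 := hL1.2.2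
  have a2 := hL2.2.2
  have a5 := h35.2.2
  have a7 := hL7.2.2
  have bA : A.card ≤ n := by simpa using Finset.card_le_univ A
  have bB : B.card ≤ n := by simpa using Finset.card_le_univ B
  have bC : (symmDiff A B).card ≤ n := by simpa using Finset.card_le_univ (symmDiff A B)
  rw [List.length_append, List.length_append, hlA, hlB, hlC] at hlen6
  have b1 : 200 * (A.card + B.card + (symmDiff A B).card) * (k + 1) ≤ 600 * n * (k + 1) :=
    Nat.mul_le_mul_right _ (by omega)
  have b2 : 192 * 2 ^ (k + 1) = 384 * 2 ^ k := by ring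
  simp only [List.length_nil] at a1
  omega

/-- There is a constant `K` such that for every `n`, all
`A, B ⊆ {x_1,…,x_n}` with `|A| ≥ 4`, `|B| ≥ 4`, `|A △ B| ≥ 4` and all orderings `σa`
of `A` and `σb` of `B`, the formula `rAddPar(a, b)` has an extended resolution
refutation with at most `K·n·log n` lines. -/
theorem rAddPar_short_er_refutation :
    ∃ K : ℝ, ∀ (n : ℕ) (A B : Finset (Fin n)),
      4 ≤ A.card → 4 ≤ B.card → 4 ≤ (symmDiff A B).card →
      ∀ σa σb : Equiv.Perm (Fin n),
        ∃ L : List (Clause ℕ),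
          IsERRefutation (rAddPar n A B σa σb (Equiv.refl (Fin n))) L ∧
          (L.length : ℝ) ≤ K * n * Real.log n := by
  refine ⟨10000, ?_⟩
  intro n A B hA hB hC σa σb
  have hn : 4 ≤ n := hA.trans (by simpa using Finset.card_le_univ A)
  obtain ⟨L, hL, hlen⟩ := refute_nat n A B hA hB hC σa σb (Equiv.refl _) (Nat.log 2 n + 1)
    (Nat.lt_pow_succ_log_self (by norm_num) n).le
  refine ⟨L, hL, ?_⟩
  have hpow : 2 ^ (Nat.log 2 n) ≤ n := Nat.pow_log_le_self 2 (by omega)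
  have hpow' : 2 ^ (Nat.log 2 n + 1) ≤ 2 * n := by rw [pow_succ]; omega
  have hn0 : (4 : ℝ) ≤ n := by exact_mod_cast hn
  have hlog1 : 1 ≤ Real.log n := by
    rw [Real.le_log_iff_exp_le (by linarith)]
    have := Real.exp_one_lt_d9
    linarith
  have hk : ((Nat.log 2 n : ℕ) : ℝ) ≤ 2 * Real.log n := by
    have h1 : ((2 : ℝ)) ^ (Nat.log 2 n) ≤ n := by exact_mod_cast hpow
    have h2 := Real.log_le_log (by positivity) h1
    rw [Real.log_pow] at h2
    have := Real.log_two_gt_d9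
    have h3 : (0 : ℝ) ≤ (Nat.log 2 n : ℕ) := Nat.cast_nonneg _
    nlinarith
  have hlen' : (L.length : ℝ) ≤ 1400 + 600 * n * ((Nat.log 2 n : ℕ) + 1 + 1) + 384 * (2 * n) := by
    have : L.length ≤ 1400 + 600 * n * (Nat.log 2 n + 1 + 1) + 384 * (2 * n) := by omega
    exact_mod_cast this
  have hnl : (n : ℝ) ≤ n * Real.log n := by nlinarith
  have hnk : (n : ℝ) * (Nat.log 2 n : ℕ) ≤ n * (2 * Real.log n) :=
    mul_le_mul_of_nonneg_left hk (by linarith)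
  nlinarith
end
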